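/- arXiv:1701.02827 — 2 statements merged into one kernel-verified Lean document; each statement's English description precedes it below -/
import Mathlib

section
/- Conditional strong functional representation lemma: for any jointly distributed random variables (U,X,Y) (over Polish spaces with Borel probability measures) with I(X;Y|U) < ∞, there exists a random variable Z such that Z is independent of the pair (X,U), Y is almost surely equal to a measurable function g(X,Z,U), and I(X;Z|Y,U) ≤ log₂(I(X;Y|U)+1) + 4 bits. -/
open MeasureTheory ProbabilityTheory Real
open scoped ENNReal

noncomputable section
open Classical in

/-- Kullback–Leibler divergence in bits (base-2 logarithm). -/
def klBits {α : Type*} [MeasurableSpace α] (P Q : Measure α) : ℝ≥0∞ :=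
  if P ≪ Q ∧ Integrable (fun x => Real.logb 2 (P.rnDeriv Q x).toReal) P
  then ENNReal.ofReal (∫ x, Real.logb 2 (P.rnDeriv Q x).toReal ∂P)
  else ⊤

/-- Mutual information `I(X;Y)` in bits: the KL divergence between the joint law and the
product of the marginal laws. -/
def miBits {Ω 𝒳 𝒴 : Type*} [MeasurableSpace Ω] [MeasurableSpace 𝒳] [MeasurableSpace 𝒴]
    (μ : Measure Ω) (X : Ω → 𝒳) (Y : Ω → 𝒴) : ℝ≥0∞ :=
  klBits (μ.map (fun ω => (X ω, Y ω))) ((μ.map X).prod (μ.map Y))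

/-- Conditional mutual information `I(X;Z|Y)` in bits, defined via the chain rule
`I(X;Z|Y) = I(X;(Z,Y)) - I(X;Y)`. -/
def cmiBits {Ω 𝒳 𝒵 𝒴 : Type*} [MeasurableSpace Ω] [MeasurableSpace 𝒳] [MeasurableSpace 𝒵]
    [MeasurableSpace 𝒴] (μ : Measure Ω) (X : Ω → 𝒳) (Z : Ω → 𝒵) (Y : Ω → 𝒴) : ℝ≥0∞ :=
  miBits μ X (fun ω => (Z ω, Y ω)) - miBits μ X Y

/-- Entropy `H(X)` in bits, as `I(X;X)` (equals the Shannon entropy for discrete `X`,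
and `∞` otherwise). -/
def entBits {Ω 𝒳 : Type*} [MeasurableSpace Ω] [MeasurableSpace 𝒳]
    (μ : Measure Ω) (X : Ω → 𝒳) : ℝ≥0∞ :=
  miBits μ X X

/-- Conditional entropy `H(Y|Z)` in bits, as `I(Y;Y|Z)`. -/
def condEntBits {Ω 𝒴 𝒵 : Type*} [MeasurableSpace Ω] [MeasurableSpace 𝒴] [MeasurableSpace 𝒵]
    (μ : Measure Ω) (Y : Ω → 𝒴) (Z : Ω → 𝒵) : ℝ≥0∞ :=
  cmiBits μ Y Y Z

/-- Mutual information of a joint distribution on a product space. -/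
def miOfJoint {𝒳 𝒴 : Type*} [MeasurableSpace 𝒳] [MeasurableSpace 𝒴]
    (ν : Measure (𝒳 × 𝒴)) : ℝ≥0∞ :=
  miBits ν Prod.fst Prod.snd

/-! ### Scalar inequalities -/

lemma sfr_kl_base (b : ℝ) (h0 : 0 ≤ b) (h1 : b ≤ 1) :
    (1 - b) ^ 2 / 2 ≤ InformationTheory.klFun b := by
  have key : AntitoneOn (fun x => InformationTheory.klFun x - (1 - x) ^ 2 / 2) (Set.Icc 0 1) := by
    apply antitoneOn_of_deriv_nonpos (convex_Icc 0 1)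
    · apply Continuous.continuousOn
      have := InformationTheory.continuous_klFun
      fun_prop
    · intro x hx
      rw [interior_Icc] at hx
      exact ((InformationTheory.hasDerivAt_klFun hx.1.ne').differentiableAt.sub
        (by fun_prop)).differentiableWithinAt
    · intro x hx
      rw [interior_Icc] at hx
      have h2 : HasDerivAt (fun x : ℝ => InformationTheory.klFun x - (1 - x) ^ 2 / 2)
          (log x - (2 * (1 - x) ^ (2 - 1) * (0 - 1)) / 2) x := by
        refine (InformationTheory.hasDerivAt_klFun hx.1.ne').sub (HasDerivAt.div_const ?_ 2)
        exact ((hasDerivAt_const x (1 : ℝ)).sub (hasDerivAt_id x)).pow 2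
      rw [h2.deriv]
      have := log_le_sub_one_of_pos hx.1
      norm_num
      linarith
  have := key ⟨h0, h1⟩ ⟨zero_le_one, le_rfl⟩ h1
  simp only [InformationTheory.klFun_one] at this
  norm_num at this
  linarith

lemma sfr_kl_step (a r α : ℝ) (ha : 1 ≤ a) (h0 : 0 ≤ α) (h1 : α ≤ r) :
    InformationTheory.klFun a + α * (log (a + r) - r + α / 2)
      ≤ InformationTheory.klFun (a + α) := by
  have key : MonotoneOn (fun x => InformationTheory.klFun (a + x)
      - x * (log (a + r) - r + x / 2)) (Set.Icc 0 r) := by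
    apply monotoneOn_of_deriv_nonneg (convex_Icc 0 r)
    · apply Continuous.continuousOn
      have := InformationTheory.continuous_klFun
      fun_prop
    · intro x hx
      rw [interior_Icc] at hx
      have hx0 : a + x ≠ 0 := by linarith [hx.1]
      have h3 : HasDerivAt (fun x => InformationTheory.klFun (a + x)) (log (a + x)) x := by
        simpa using (InformationTheory.hasDerivAt_klFun hx0).comp_const_add a x
      exact (h3.differentiableAt.sub (by fun_prop)).differentiableWithinAt
    · intro x hx
      rw [interior_Icc] at hx
      have hx0 : a + x ≠ 0 := by linarith [hx.1]
      have h3 : HasDerivAt (fun x => InformationTheory.klFun (a + x)) (log (a + x)) x := by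
        simpa using (InformationTheory.hasDerivAt_klFun hx0).comp_const_add a x
      have h2 : HasDerivAt (fun x : ℝ => InformationTheory.klFun (a + x)
          - x * (log (a + r) - r + x / 2))
          (log (a + x) - (1 * (log (a + r) - r + x / 2) + x * (1 / 2))) x := by
        refine h3.sub ?_
        exact (hasDerivAt_id x).mul (((hasDerivAt_id x).div_const 2).const_add _)
      rw [h2.deriv]
      have hp : 0 < a + x := by linarith [hx.1]
      have hq : 0 < a + r := by linarith [hx.1, hx.2]
      have h4 := log_le_sub_one_of_pos (div_pos hq hp)
      rw [log_div hq.ne' hp.ne'] at h4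
      have h5 : (a + r) / (a + x) - 1 ≤ r - x := by
        rw [div_sub_one hp.ne', div_le_iff₀ hp]
        nlinarith [hx.1, hx.2]
      linarith
  have := key ⟨le_rfl, h0.trans h1⟩ ⟨h0, h1⟩ h0
  simp only [add_zero, zero_mul, sub_zero] at this
  linarith

lemma sfr_kl_mono {a b : ℝ} (ha : 1 ≤ a) (hab : a ≤ b) :
    InformationTheory.klFun a ≤ InformationTheory.klFun b := by
  have key : MonotoneOn InformationTheory.klFun (Set.Ici 1) := by
    apply monotoneOn_of_deriv_nonneg (convex_Ici 1)
    · exact InformationTheory.continuous_klFun.continuousOn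
    · intro x hx
      rw [interior_Ici] at hx
      have hx : 1 < x := hx
      exact (InformationTheory.hasDerivAt_klFun (by linarith)).differentiableAt.differentiableWithinAt
    · intro x hx
      rw [interior_Ici] at hx
      have hx : 1 < x := hx
      rw [InformationTheory.deriv_klFun]
      exact log_nonneg hx.le
  exact key ha (ha.trans hab) hab

lemma sfr_ent_step (r r' : ℝ) (h0 : 0 ≤ r') (h1 : r' ≤ r) :
    (r - r') * (-log r) ≤ (r - r * log r) - (r' - r' * log r') := by
  rcases h0.eq_or_lt with h | h
  · subst h; simp; linarith
  · have hr : 0 < r := h.trans_le h1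
    have h4 := log_le_sub_one_of_pos (div_pos hr h)
    rw [log_div hr.ne' h.ne'] at h4
    have h5 : r' * (log r - log r') ≤ r' * (r / r' - 1) := mul_le_mul_of_nonneg_left h4 h0
    have h6 : r' * (r / r' - 1) = r - r' := by field_simp
    nlinarith

/-! ### The greedy rejection sampler -/

section Greedy
variable {B : Type*} [MeasurableSpace B]

def gS (β : Measure B) (f : B → ℝ) : ℕ → ℝ
  | 0 => 0
  | n + 1 => gS β f n + ∫ b, max (f b - gS β f n) 0 ∂β

def gr (β : Measure B) (f : B → ℝ) (n : ℕ) : ℝ := ∫ b, max (f b - gS β f n) 0 ∂β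

def gα (β : Measure B) (f : B → ℝ) (n : ℕ) (b : B) : ℝ :=
  min (f b) (gS β f (n + 1)) - min (f b) (gS β f n)

variable {β : Measure B} {f : B → ℝ}

lemma gS_succ (n : ℕ) : gS β f (n + 1) = gS β f n + gr β f n := rfl

lemma gr_nonneg (n : ℕ) : 0 ≤ gr β f n := integral_nonneg fun _ => le_max_right _ _

lemma gS_mono : Monotone (gS β f) :=
  monotone_nat_of_le_succ fun n => by rw [gS_succ]; linarith [gr_nonneg (β := β) (f := f) n]

lemma gα_nonneg (n : ℕ) (b : B) : 0 ≤ gα β f n b := by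
  unfold gα
  linarith [min_le_min_left (f b) (gS_mono (β := β) (f := f) (Nat.le_succ n))]

lemma gα_le (n : ℕ) (b : B) : gα β f n b ≤ gr β f n := by
  unfold gα
  rw [gS_succ]
  have := gr_nonneg (β := β) (f := f) n
  rcases min_cases (f b) (gS β f n + gr β f n) with h | h <;>
  rcases min_cases (f b) (gS β f n) with h' | h' <;> linarith [h.1, h.2, h'.1, h'.2]

lemma sum_gα (hf0 : ∀ b, 0 ≤ f b) (n : ℕ) (b : B) :
    ∑ i ∈ Finset.range n, gα β f i b = min (f b) (gS β f n) := by
  unfold gα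
  rw [Finset.sum_range_sub (fun i => min (f b) (gS β f i))]
  simp [gS, hf0 b]

variable [IsProbabilityMeasure β]

lemma gS_nonneg (n : ℕ) : 0 ≤ gS β f n := gS_mono (β := β) (f := f) (Nat.zero_le n)

lemma integrable_min (hfi : Integrable f β) (c : ℝ) : Integrable (fun b => min (f b) c) β :=
  hfi.inf (integrable_const c)

lemma gr_eq (hfi : Integrable f β) (hf1 : ∫ b, f b ∂β = 1) (n : ℕ) :
    gr β f n = 1 - ∫ b, min (f b) (gS β f n) ∂β := by
  rw [gr, ← hf1, ← integral_sub hfi (integrable_min hfi _)]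
  congr 1; ext b
  rcases le_total (f b) (gS β f n) with h | h
  · rw [min_eq_left h, max_eq_right (by linarith)]; ring
  · rw [min_eq_right h, max_eq_left (by linarith)]

lemma integrable_gα (hfi : Integrable f β) (n : ℕ) : Integrable (gα β f n) β :=
  (integrable_min hfi _).sub (integrable_min hfi _)

lemma integral_gα (hfi : Integrable f β) (hf1 : ∫ b, f b ∂β = 1) (n : ℕ) :
    ∫ b, gα β f n b ∂β = gr β f n - gr β f (n + 1) := by
  rw [gr_eq hfi hf1, gr_eq hfi hf1]
  unfold gα
  rw [integral_sub (integrable_min hfi _) (integrable_min hfi _)]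
  ring

lemma gr_zero (hf0 : ∀ b, 0 ≤ f b) (hf1 : ∫ b, f b ∂β = 1) : gr β f 0 = 1 := by
  simp [gr, gS, hf0, hf1]

lemma gS_one (hf0 : ∀ b, 0 ≤ f b) (hf1 : ∫ b, f b ∂β = 1) : gS β f 1 = 1 := by
  rw [gS_succ, gr_zero hf0 hf1]; simp [gS]

lemma gr_anti (hfi : Integrable f β) (hf1 : ∫ b, f b ∂β = 1) : Antitone (gr β f) :=
  antitone_nat_of_succ_le fun n => by
    have h1 := integral_gα hfi hf1 n
    have h2 : 0 ≤ ∫ b, gα β f n b ∂β := integral_nonneg fun b => gα_nonneg n b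
    linarith

lemma mul_gr_le (hfi : Integrable f β) (hf1 : ∫ b, f b ∂β = 1) (n : ℕ) :
    ((n : ℝ) + 1) * gr β f n ≤ gS β f (n + 1) := by
  induction n with
  | zero => rw [gS_succ]; simp [gS]
  | succ n ih =>
    rw [gS_succ]
    have h := gr_anti hfi hf1 (Nat.le_succ n)
    push_cast
    have h2 : ((n : ℝ) + 1) * gr β f (n + 1) ≤ ((n : ℝ) + 1) * gr β f n :=
      mul_le_mul_of_nonneg_left h (by positivity)
    linarith

lemma g_pointwise (hf0 : ∀ b, 0 ≤ f b) (hf1 : ∫ b, f b ∂β = 1) (n : ℕ) (b : B) :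
    (1 - gα β f 0 b) ^ 2 / 2 + ∑ i ∈ Finset.range n, gα β f (i + 1) b *
      (log (gS β f (i + 2)) - gr β f (i + 1) + gα β f (i + 1) b / 2)
      ≤ InformationTheory.klFun (min (f b) (gS β f (n + 1))) := by
  induction n with
  | zero =>
    have h1 := gS_one hf0 hf1
    have h2 : gα β f 0 b = min (f b) 1 := by unfold gα; rw [zero_add, h1]; simp [gS, hf0 b]
    simp only [Finset.range_zero, Finset.sum_empty, add_zero, zero_add, h1, h2]
    exact sfr_kl_base _ (le_min (hf0 b) zero_le_one) (min_le_right _ _)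
  | succ n ih =>
    rw [Finset.sum_range_succ, ← add_assoc]
    refine (add_le_add_left ih _).trans ?_
    have hS : 1 ≤ gS β f (n + 1) := by
      rw [← gS_one hf0 hf1]; exact gS_mono (by omega)
    have hm : min (f b) (gS β f (n + 1 + 1)) = min (f b) (gS β f (n + 1)) + gα β f (n + 1) b := by
      unfold gα; ring
    rcases le_total (f b) (gS β f (n + 1)) with h | h
    · have h2 : gα β f (n + 1) b = 0 := by
        unfold gα
        rw [min_eq_left h, min_eq_left (h.trans (gS_mono (by omega)))]; ring
      rw [hm, h2]; simp
    · rw [hm, min_eq_right h]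
      exact sfr_kl_step _ _ _ hS (gα_nonneg _ _) (gα_le _ _)

lemma sq_integral_le {g : B → ℝ} (hg : Integrable g β) (hg2 : Integrable (fun b => g b ^ 2) β) :
    (∫ b, g b ∂β) ^ 2 ≤ ∫ b, g b ^ 2 ∂β := by
  set c := ∫ b, g b ∂β with hc
  have h : 0 ≤ ∫ b, (g b - c) ^ 2 ∂β := integral_nonneg fun b => sq_nonneg _
  have h2 : ∫ b, (g b - c) ^ 2 ∂β = ∫ b, g b ^ 2 ∂β - c ^ 2 := by
    have : ∀ b, (g b - c) ^ 2 = g b ^ 2 - 2 * c * g b + c ^ 2 := fun b => by ring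
    simp_rw [this]
    have hA : Integrable (fun b => g b ^ 2 - 2 * c * g b) β := hg2.sub (hg.const_mul _)
    rw [integral_add hA (integrable_const _),
      integral_sub hg2 (hg.const_mul _), integral_const_mul, ← hc]
    simp; ring
  linarith

lemma integrable_gα_sq (hfi : Integrable f β) (n : ℕ) :
    Integrable (fun b => gα β f n b ^ 2) β := by
  refine Integrable.mono' (integrable_const ((gr β f n) ^ 2)) 
    ((integrable_gα hfi n).aestronglyMeasurable.pow 2) (ae_of_all _ fun b => ?_)
  rw [norm_of_nonneg (sq_nonneg _)]
  exact pow_le_pow_left₀ (gα_nonneg n b) (gα_le n b) 2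

lemma integrable_kl_min (hf0 : ∀ b, 0 ≤ f b) (hfi : Integrable f β) (c : ℝ) (hc : 0 ≤ c) :
    Integrable (fun b => InformationTheory.klFun (min (f b) c)) β := by
  obtain ⟨M, hM⟩ := (isCompact_Icc (a := (0 : ℝ)) (b := c)).exists_bound_of_continuousOn
    InformationTheory.continuous_klFun.continuousOn
  refine Integrable.mono' (integrable_const M)
    (InformationTheory.continuous_klFun.comp_aestronglyMeasurable
      (integrable_min hfi c).aestronglyMeasurable) (ae_of_all _ fun b => ?_)
  exact hM _ ⟨le_min (hf0 b) hc, min_le_right _ _⟩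

lemma g_sum_S (hf0 : ∀ b, 0 ≤ f b) (hfi : Integrable f β) (hf1 : ∫ b, f b ∂β = 1) (n : ℕ) :
    ∑ i ∈ Finset.range (n + 1), (gr β f i - gr β f (i + 1)) * log (gS β f (i + 1))
      ≤ ∫ b, InformationTheory.klFun (min (f b) (gS β f (n + 1))) ∂β := by
  have hi0 : Integrable (fun b => (1 - gα β f 0 b) ^ 2) β := by
    have : ∀ b, (1 - gα β f 0 b) ^ 2 = 1 - 2 * gα β f 0 b + gα β f 0 b ^ 2 := fun b => by ring
    simp_rw [this]
    exact ((integrable_const _).sub ((integrable_gα hfi 0).const_mul 2)).add (integrable_gα_sq hfi 0)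
  have hrw : ∀ i b, gα β f (i + 1) b *
      (log (gS β f (i + 2)) - gr β f (i + 1) + gα β f (i + 1) b / 2) =
      (log (gS β f (i + 2)) - gr β f (i + 1)) * gα β f (i + 1) b + (1 / 2) * gα β f (i + 1) b ^ 2 :=
    fun i b => by ring
  have hii : ∀ i, Integrable (fun b => gα β f (i + 1) b *
      (log (gS β f (i + 2)) - gr β f (i + 1) + gα β f (i + 1) b / 2)) β := fun i => by
    simp_rw [hrw]
    exact ((integrable_gα hfi _).const_mul _).add ((integrable_gα_sq hfi _).const_mul _)
  have key := integral_mono ((hi0.div_const 2).add (integrable_finsetSum (Finset.range n)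
    (fun i _ => hii i))) (integrable_kl_min hf0 hfi _ (gS_nonneg (n + 1)))
    (fun b => g_pointwise hf0 hf1 n b)
  refine le_trans ?_ key
  simp only [Pi.add_apply]
  rw [integral_add (hi0.div_const 2) (integrable_finsetSum (Finset.range n)
    (fun i _ => hii i)), integral_finsetSum _ (fun i _ => hii i), integral_div]
  have h0 : gr β f 1 ^ 2 / 2 ≤ (∫ b, (1 - gα β f 0 b) ^ 2 ∂β) / 2 := by
    have h := sq_integral_le ((integrable_const (1 : ℝ)).sub (integrable_gα hfi 0)) hi0
    simp only [Pi.sub_apply] at h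
    rw [integral_sub (integrable_const (1 : ℝ)) (integrable_gα hfi 0), integral_gα hfi hf1,
      gr_zero hf0 hf1] at h
    simp at h
    linarith
  have h1 : ∀ i, (gr β f (i + 1) - gr β f (i + 2)) * log (gS β f (i + 2))
      - (gr β f (i + 1) ^ 2 - gr β f (i + 2) ^ 2) / 2 ≤ ∫ b, gα β f (i + 1) b *
      (log (gS β f (i + 2)) - gr β f (i + 1) + gα β f (i + 1) b / 2) ∂β := fun i => by
    simp_rw [hrw]
    rw [integral_add ((integrable_gα hfi _).const_mul _) ((integrable_gα_sq hfi _).const_mul _),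
      integral_const_mul, integral_const_mul, integral_gα hfi hf1]
    have h := sq_integral_le (integrable_gα (β := β) hfi (i + 1)) (integrable_gα_sq hfi _)
    rw [integral_gα hfi hf1] at h
    simp only [add_assoc, Nat.reduceAdd] at h ⊢
    nlinarith
  have h2 := Finset.sum_le_sum (s := Finset.range n) (fun i _ => h1 i)
  rw [Finset.sum_sub_distrib, ← Finset.sum_div,
    Finset.sum_range_sub' (fun i => gr β f (i + 1) ^ 2)] at h2
  rw [Finset.sum_range_succ', gS_one hf0 hf1]
  simp only [add_assoc, Nat.reduceAdd, zero_add, log_one, mul_zero, add_zero] at h2 ⊢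
  have := sq_nonneg (gr β f (n + 1))
  linarith

lemma g_sum_r (hf0 : ∀ b, 0 ≤ f b) (hfi : Integrable f β) (hf1 : ∫ b, f b ∂β = 1) (n : ℕ) :
    ∑ i ∈ Finset.range n, (gr β f i - gr β f (i + 1)) * (-log (gr β f i)) ≤ 1 := by
  have h1 := Finset.sum_le_sum (s := Finset.range n)
    (fun i _ => sfr_ent_step (gr β f i) (gr β f (i + 1)) (gr_nonneg _)
      (gr_anti hfi hf1 (Nat.le_succ i)))
  rw [Finset.sum_range_sub' (fun i => gr β f i - gr β f i * log (gr β f i)), gr_zero hf0 hf1] at h1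
  have h2 : gr β f n ≤ 1 := by
    rw [← gr_zero hf0 hf1]; exact gr_anti hfi hf1 (Nat.zero_le n)
  have h3 := mul_log_nonpos (gr_nonneg (β := β) (f := f) n) h2
  have h4 := gr_nonneg (β := β) (f := f) n
  simp only [log_one, mul_zero, sub_zero] at h1
  linarith

lemma g_sum_log (hf0 : ∀ b, 0 ≤ f b) (hfi : Integrable f β) (hf1 : ∫ b, f b ∂β = 1) (n : ℕ) :
    ∑ i ∈ Finset.range (n + 1), (gr β f i - gr β f (i + 1)) * log ((i : ℝ) + 1)
      ≤ 1 + ∫ b, InformationTheory.klFun (min (f b) (gS β f (n + 1))) ∂β := by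
  have h1 := g_sum_S hf0 hfi hf1 n
  have h2 := g_sum_r hf0 hfi hf1 (n + 1)
  refine le_trans ?_ (add_le_add h2 h1)
  rw [← Finset.sum_add_distrib]
  refine Finset.sum_le_sum fun i _ => ?_
  rw [← mul_add]
  have h3 : 0 ≤ gr β f i - gr β f (i + 1) := by linarith [gr_anti hfi hf1 (Nat.le_succ i)]
  rcases (gr_nonneg (β := β) (f := f) i).eq_or_lt with h | h
  · have : gr β f i - gr β f (i + 1) = 0 := by
      linarith [gr_nonneg (β := β) (f := f) (i + 1)]
    rw [this]; simp
  · refine mul_le_mul_of_nonneg_left ?_ h3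
    have h5 := mul_gr_le hfi hf1 i
    have h6 : (0 : ℝ) < (i : ℝ) + 1 := by positivity
    have h7 := log_le_log (by positivity) h5
    rw [log_mul h6.ne' h.ne'] at h7
    linarith

lemma g_tsum_log (hf0 : ∀ b, 0 ≤ f b) (hfi : Integrable f β)
    (hf1 : ∫ b, f b ∂β = 1) :
    ∑' i, ENNReal.ofReal ((gr β f i - gr β f (i + 1)) * log ((i : ℝ) + 1))
      ≤ 1 + ∫⁻ b, ENNReal.ofReal (InformationTheory.klFun (f b)) ∂β := by
  refine ENNReal.tsum_le_of_sum_range_le fun n => ?_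
  have hnn : ∀ i, 0 ≤ (gr β f i - gr β f (i + 1)) * log ((i : ℝ) + 1) := fun i =>
    mul_nonneg (by linarith [gr_anti hfi hf1 (Nat.le_succ i)]) (log_nonneg (by simp))
  calc _ ≤ ∑ i ∈ Finset.range (n + 1),
        ENNReal.ofReal ((gr β f i - gr β f (i + 1)) * log ((i : ℝ) + 1)) :=
        Finset.sum_le_sum_of_subset (Finset.range_mono (Nat.le_succ n))
    _ = ENNReal.ofReal (∑ i ∈ Finset.range (n + 1),
        ((gr β f i - gr β f (i + 1)) * log ((i : ℝ) + 1))) :=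
        (ENNReal.ofReal_sum_of_nonneg fun i _ => hnn i).symm
    _ ≤ ENNReal.ofReal (1 + ∫ b, InformationTheory.klFun (min (f b) (gS β f (n + 1))) ∂β) :=
        ENNReal.ofReal_le_ofReal (g_sum_log hf0 hfi hf1 n)
    _ ≤ 1 + ENNReal.ofReal (∫ b, InformationTheory.klFun (min (f b) (gS β f (n + 1))) ∂β) := by
        refine ENNReal.ofReal_add_le.trans ?_
        simp
    _ ≤ _ := by
        gcongr
        rw [ofReal_integral_eq_lintegral_ofReal (integrable_kl_min hf0 hfi _ (gS_nonneg _))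
          (ae_of_all _ fun b => InformationTheory.klFun_nonneg (le_min (hf0 b) (gS_nonneg _)))]
        refine lintegral_mono fun b => ENNReal.ofReal_le_ofReal ?_
        rcases le_total (f b) (gS β f (n + 1)) with h | h
        · rw [min_eq_left h]
        · rw [min_eq_right h]
          refine sfr_kl_mono ?_ h
          rw [← gS_one hf0 hf1]; exact gS_mono (by omega)

lemma gr_tendsto (hf0 : ∀ b, 0 ≤ f b) (hfi : Integrable f β) (hf1 : ∫ b, f b ∂β = 1) :
    Filter.Tendsto (gr β f) Filter.atTop (nhds 0) := by
  have hbdd : BddBelow (Set.range (gr β f)) := ⟨0, by rintro _ ⟨n, rfl⟩; exact gr_nonneg n⟩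
  have h := tendsto_atTop_ciInf (gr_anti hfi hf1) hbdd
  set L := ⨅ n, gr β f n with hL
  have hLle : ∀ n, L ≤ gr β f n := fun n => ciInf_le hbdd n
  have hL0 : 0 ≤ L := le_ciInf fun n => gr_nonneg n
  rcases hL0.eq_or_lt with h0 | hpos
  · rwa [← h0] at h
  exfalso
  have hS : ∀ n : ℕ, n * L ≤ gS β f n := by
    intro n
    induction n with
    | zero => simp [gS]
    | succ n ih => rw [gS_succ]; push_cast; linarith [hLle n]
  have hD : Filter.Tendsto (fun n : ℕ => ∫ b, max (f b - n * L) 0 ∂β) Filter.atTop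
      (nhds (∫ b, (0 : ℝ) ∂β)) := by
    refine tendsto_integral_of_dominated_convergence f (fun n => ?_) hfi (fun n => ?_) ?_
    · exact ((hfi.sub (integrable_const _)).sup (integrable_const 0)).aestronglyMeasurable
    · refine ae_of_all _ fun b => ?_
      rw [norm_of_nonneg (le_max_right _ _)]
      exact max_le (by nlinarith [Nat.cast_nonneg (α := ℝ) n]) (hf0 b)
    · refine ae_of_all _ fun b => ?_
      obtain ⟨N, hN⟩ := exists_nat_ge (f b / L)
      refine tendsto_const_nhds.congr' ?_
      filter_upwards [Filter.eventually_ge_atTop N] with n hn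
      rw [max_eq_right]
      have : f b / L ≤ n := hN.trans (by exact_mod_cast hn)
      rw [div_le_iff₀ hpos] at this
      linarith
  simp only [integral_zero] at hD
  have : L ≤ 0 := ge_of_tendsto' hD fun n => (hLle n).trans <| by
    refine integral_mono ((hfi.sub (integrable_const _)).sup (integrable_const 0))
      ((hfi.sub (integrable_const _)).sup (integrable_const 0)) fun b => ?_
    exact max_le_max (by linarith [hS n]) le_rfl
  linarith

end Greedy

section Sampler
variable {B : Type*} [MeasurableSpace B]

/-- acceptance set at step n -/
def gE (β : Measure B) (f : B → ℝ) (n : ℕ) : Set (B × unitInterval) :=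
  {p | (p.2 : ℝ) * gr β f n < gα β f n p.1}

/-- first accepted index -/
def gK (β : Measure B) (f : B → ℝ) (z : ℕ → B × unitInterval) : ℕ :=
  sInf {n | z n ∈ gE β f n}

def gG (β : Measure B) (f : B → ℝ) (n : ℕ) : Set (ℕ → B × unitInterval) :=
  {z | (∀ j < n, z j ∉ gE β f j) ∧ z n ∈ gE β f n}

def gν (β : Measure B) : Measure (B × unitInterval) := β.prod volume

instance (β : Measure B) [IsProbabilityMeasure β] : IsProbabilityMeasure (gν β) := by
  unfold gν; infer_instance

def gπ (β : Measure B) [IsProbabilityMeasure β] : Measure (ℕ → B × unitInterval) :=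
  Measure.infinitePi (fun _ => gν β)

instance (β : Measure B) [IsProbabilityMeasure β] : IsProbabilityMeasure (gπ β) := by
  unfold gπ; infer_instance

variable {β : Measure B} {f : B → ℝ}

lemma gK_of_mem {n : ℕ} {z : ℕ → B × unitInterval} (h : z ∈ gG β f n) : gK β f z = n := by
  refine IsLeast.csInf_eq ⟨h.2, fun m hm => ?_⟩
  by_contra hlt
  exact h.1 m (not_le.mp hlt) hm

lemma mem_of_gK {n : ℕ} (hn : 0 < n) {z : ℕ → B × unitInterval} (h : gK β f z = n) :
    z ∈ gG β f n := by
  have hne : {n | z n ∈ gE β f n}.Nonempty := Nat.nonempty_of_pos_sInf (by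
    change 0 < gK β f z; omega)
  refine ⟨fun j hj hjm => ?_, ?_⟩
  · have : gK β f z ≤ j := Nat.sInf_le hjm
    omega
  · have := Nat.sInf_mem hne
    change z (gK β f z) ∈ gE β f (gK β f z) at this
    rwa [h] at this

lemma gG_disjoint : Pairwise (Function.onFun Disjoint (gG β f)) := by
  intro i j hij
  refine Set.disjoint_left.2 fun z hi hj => hij ?_
  rw [← gK_of_mem hi, gK_of_mem hj]

/-! measurability in parameters -/

section meas
variable {A : Type*} [MeasurableSpace A] {F : A → B → ℝ} [SFinite β]

lemma measurable_gS (hF : Measurable (Function.uncurry F)) (n : ℕ) :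
    Measurable (fun a => gS β (F a) n) := by
  induction n with
  | zero => exact measurable_const
  | succ n ih =>
    refine ih.add ?_
    have h : Measurable (fun p : A × B => max (F p.1 p.2 - gS β (F p.1) n) 0) :=
      (hF.sub (ih.comp measurable_fst)).max measurable_const
    exact (h.stronglyMeasurable.integral_prod_right' (ν := β)).measurable

lemma measurable_gr (hF : Measurable (Function.uncurry F)) (n : ℕ) :
    Measurable (fun a => gr β (F a) n) := by
  have h : Measurable (fun p : A × B => max (F p.1 p.2 - gS β (F p.1) n) 0) :=
      (hF.sub ((measurable_gS hF n).comp measurable_fst)).max measurable_const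
  exact (h.stronglyMeasurable.integral_prod_right' (ν := β)).measurable

lemma measurable_gα (hF : Measurable (Function.uncurry F)) (n : ℕ) :
    Measurable (fun p : A × B => gα β (F p.1) n p.2) := by
  have h1 : ∀ m, Measurable (fun p : A × B => min (F p.1 p.2) (gS β (F p.1) m)) := fun m =>
    hF.min ((measurable_gS hF m).comp measurable_fst)
  exact (h1 (n + 1)).sub (h1 n)

lemma measurableSet_gE (hF : Measurable (Function.uncurry F)) (n : ℕ) :
    MeasurableSet {p : A × (B × unitInterval) | p.2 ∈ gE β (F p.1) n} := by
  have h1 : Measurable (fun p : A × (B × unitInterval) => (p.2.2 : ℝ) * gr β (F p.1) n) :=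
    (measurable_subtype_coe.comp (measurable_snd.comp measurable_snd)).mul
      ((measurable_gr hF n).comp measurable_fst)
  have h2 : Measurable (fun p : A × (B × unitInterval) => gα β (F p.1) n p.2.1) :=
    (measurable_gα hF n).comp (measurable_fst.prodMk (measurable_fst.comp measurable_snd))
  exact measurableSet_lt h1 h2

lemma measurableSet_gEz (hF : Measurable (Function.uncurry F)) (n : ℕ) :
    MeasurableSet {p : A × (ℕ → B × unitInterval) | p.2 n ∈ gE β (F p.1) n} := by
  have h : Measurable (fun p : A × (ℕ → B × unitInterval) => (p.1, p.2 n)) :=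
    measurable_fst.prodMk ((measurable_pi_apply n).comp measurable_snd)
  exact h (measurableSet_gE hF n)

lemma measurableSet_gG (hF : Measurable (Function.uncurry F)) (n : ℕ) :
    MeasurableSet {p : A × (ℕ → B × unitInterval) | p.2 ∈ gG β (F p.1) n} := by
  have h : {p : A × (ℕ → B × unitInterval) | p.2 ∈ gG β (F p.1) n} =
      (⋂ j, ⋂ (_ : j < n), {p | p.2 j ∈ gE β (F p.1) j}ᶜ) ∩ {p | p.2 n ∈ gE β (F p.1) n} := by
    ext p; simp [gG]
  rw [h]
  refine MeasurableSet.inter ?_ (measurableSet_gEz hF n)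
  exact MeasurableSet.iInter fun j => MeasurableSet.iInter fun _ => (measurableSet_gEz hF j).compl

lemma measurable_gK (hF : Measurable (Function.uncurry F)) :
    Measurable (fun p : A × (ℕ → B × unitInterval) => gK β (F p.1) p.2) := by
  have hpos : ∀ n, 0 < n → (fun p : A × (ℕ → B × unitInterval) => gK β (F p.1) p.2) ⁻¹' {n} =
      {p | p.2 ∈ gG β (F p.1) n} := by
    intro n hn
    ext p
    exact ⟨fun h => mem_of_gK hn h, fun h => gK_of_mem h⟩
  refine measurable_to_countable' fun n => ?_
  rcases Nat.eq_zero_or_pos n with rfl | hn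
  · have : (fun p : A × (ℕ → B × unitInterval) => gK β (F p.1) p.2) ⁻¹' {0} =
        (⋃ n, (fun p : A × (ℕ → B × unitInterval) => gK β (F p.1) p.2) ⁻¹' {n + 1})ᶜ := by
      ext p
      simp only [Set.mem_preimage, Set.mem_singleton_iff, Set.mem_compl_iff, Set.mem_iUnion,
        not_exists]
      refine ⟨fun h n => by omega, fun h => ?_⟩
      by_contra h0
      exact h (gK β (F p.1) p.2 - 1) (by omega)
    rw [this]
    refine (MeasurableSet.iUnion fun n => ?_).compl
    rw [hpos _ (Nat.succ_pos n)]
    exact measurableSet_gG hF _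
  · rw [hpos n hn]
    exact measurableSet_gG hF _

end meas

/-! probabilities for one fixed density -/

variable [IsProbabilityMeasure β]

lemma measurable_gα1 (hfm : Measurable f) (n : ℕ) : Measurable (gα β f n) :=
  (hfm.min measurable_const).sub (hfm.min measurable_const)

lemma measurableSet_gE1 (hfm : Measurable f) (n : ℕ) : MeasurableSet (gE β f n) :=
  measurableSet_lt ((measurable_subtype_coe.comp measurable_snd).mul measurable_const)
    ((measurable_gα1 hfm n).comp measurable_fst)

lemma vol_lt (c : ℝ) (h0 : 0 ≤ c) (h1 : c ≤ 1) :
    volume {w : unitInterval | (w : ℝ) < c} = ENNReal.ofReal c := by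
  have : {w : unitInterval | (w : ℝ) < c} = Set.Iio (⟨c, h0, h1⟩ : unitInterval) := by
    ext w; simp [← Subtype.coe_lt_coe]
  rw [this, unitInterval.volume_Iio]

lemma gν_E (hfm : Measurable f) (n : ℕ) {C : Set B} (hC : MeasurableSet C) :
    ENNReal.ofReal (gr β f n) * gν β (gE β f n ∩ Prod.fst ⁻¹' C)
      = ∫⁻ b in C, ENNReal.ofReal (gα β f n b) ∂β := by
  have hms := (measurableSet_gE1 (β := β) hfm n).inter (measurable_fst hC)
  rw [gν, Measure.prod_apply hms, ← lintegral_indicator hC, ← lintegral_const_mul' _ _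
    ENNReal.ofReal_ne_top]
  congr 1; ext b
  by_cases hb : b ∈ C
  · rw [Set.indicator_of_mem hb]
    have h1 : Prod.mk b ⁻¹' (gE β f n ∩ Prod.fst ⁻¹' C) =
        {w : unitInterval | (w : ℝ) * gr β f n < gα β f n b} := by
      ext w; simp [gE, hb]
    rw [h1]
    have hα0 := gα_nonneg (β := β) (f := f) n b
    have hα1 := gα_le (β := β) (f := f) n b
    rcases (gr_nonneg (β := β) (f := f) n).eq_or_lt with h | h
    · have : gα β f n b = 0 := by linarith
      rw [← h, this]; simp
    · have h2 : {w : unitInterval | (w : ℝ) * gr β f n < gα β f n b} =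
          {w : unitInterval | (w : ℝ) < gα β f n b / gr β f n} := by
        ext w; simp [lt_div_iff₀ h]
      rw [h2, vol_lt _ (by positivity) ((div_le_one h).2 hα1), ← ENNReal.ofReal_mul h.le]
      congr 1; field_simp
  · rw [Set.indicator_of_notMem hb]
    have h1 : Prod.mk b ⁻¹' (gE β f n ∩ Prod.fst ⁻¹' C) = ∅ := by
      ext w; simp [hb]
    rw [h1]; simp

lemma lintegral_gα (hfi : Integrable f β) (hf1 : ∫ b, f b ∂β = 1) (n : ℕ) :
    ∫⁻ b, ENNReal.ofReal (gα β f n b) ∂β = ENNReal.ofReal (gr β f n - gr β f (n + 1)) := by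
  rw [← ofReal_integral_eq_lintegral_ofReal (integrable_gα hfi n)
    (ae_of_all _ fun b => gα_nonneg n b), integral_gα hfi hf1]

lemma prod_reject (hf0 : ∀ b, 0 ≤ f b) (hfm : Measurable f) (hfi : Integrable f β)
    (hf1 : ∫ b, f b ∂β = 1) (n : ℕ) :
    ∏ j ∈ Finset.range n, gν β (gE β f j)ᶜ = ENNReal.ofReal (gr β f n) := by
  induction n with
  | zero => simp [gr_zero hf0 hf1]
  | succ n ih =>
    rw [Finset.prod_range_succ, ih, prob_compl_eq_one_sub (measurableSet_gE1 hfm n),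
      ENNReal.mul_sub (fun _ _ => ENNReal.ofReal_ne_top), mul_one]
    have h := gν_E (β := β) hfm n MeasurableSet.univ
    simp only [Set.preimage_univ, Set.inter_univ, Measure.restrict_univ] at h
    rw [h, lintegral_gα hfi hf1, ← ENNReal.ofReal_sub]
    · congr 1; ring
    · linarith [gr_anti hfi hf1 (Nat.le_succ n)]

lemma gπ_G (hf0 : ∀ b, 0 ≤ f b) (hfm : Measurable f) (hfi : Integrable f β)
    (hf1 : ∫ b, f b ∂β = 1) (n : ℕ) {C : Set B} (hC : MeasurableSet C) :
    gπ β (gG β f n ∩ {z | (z n).1 ∈ C}) = ∫⁻ b in C, ENNReal.ofReal (gα β f n b) ∂β := by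
  have h : gG β f n ∩ {z | (z n).1 ∈ C} = Set.pi (Finset.range (n + 1) : Finset ℕ)
      (fun j => if j = n then gE β f n ∩ Prod.fst ⁻¹' C else (gE β f j)ᶜ) := by
    ext z
    simp only [gG, Set.mem_inter_iff, Set.mem_ofPred_eq, Set.mem_pi, Finset.coe_range, Set.mem_Iio]
    constructor
    · rintro ⟨⟨h1, h2⟩, h3⟩ j hj
      split_ifs with hjn
      · subst hjn; exact ⟨h2, h3⟩
      · exact h1 j (by omega)
    · intro h
      have hn := h n (by omega)
      rw [if_pos rfl] at hn
      refine ⟨⟨fun j hj => ?_, hn.1⟩, hn.2⟩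
      have := h j (by omega)
      rw [if_neg (by omega)] at this
      exact this
  rw [h, gπ, Measure.infinitePi_pi]
  · rw [Finset.prod_range_succ, if_pos rfl, ← gν_E hfm n hC, ← prod_reject hf0 hfm hfi hf1 n]
    congr 1
    refine Finset.prod_congr rfl fun j hj => ?_
    rw [if_neg (by have := Finset.mem_range.1 hj; omega)]
  · intro j _
    split_ifs with hjn
    · exact (measurableSet_gE1 hfm n).inter (measurable_fst hC)
    · exact (measurableSet_gE1 hfm j).compl

lemma measurableSet_gG1 (hfm : Measurable f) (n : ℕ) : MeasurableSet (gG β f n) := by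
  have h := measurableSet_gG (A := Unit) (β := β) (F := fun _ => f) (hfm.comp measurable_snd) n
  exact (measurable_prodMk_left (x := ())) h

lemma measurable_gK1 (hfm : Measurable f) : Measurable (gK β f) := by
  have h := measurable_gK (A := Unit) (β := β) (F := fun _ => f) (hfm.comp measurable_snd)
  exact h.comp (measurable_prodMk_left (x := ()))

lemma tsum_gr (hf0 : ∀ b, 0 ≤ f b) (hfi : Integrable f β) (hf1 : ∫ b, f b ∂β = 1) :
    ∑' n, ENNReal.ofReal (gr β f n - gr β f (n + 1)) = 1 := by
  have h : HasSum (fun n => gr β f n - gr β f (n + 1)) 1 := by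
    rw [hasSum_iff_tendsto_nat_of_nonneg
      (fun n => by linarith [gr_anti hfi hf1 (Nat.le_succ n)])]
    simp_rw [Finset.sum_range_sub', gr_zero hf0 hf1]
    simpa using (gr_tendsto hf0 hfi hf1).const_sub 1
  rw [← ENNReal.ofReal_tsum_of_nonneg (fun n => by linarith [gr_anti hfi hf1 (Nat.le_succ n)])
    h.summable, h.tsum_eq]
  simp

lemma gπ_iUnion (hf0 : ∀ b, 0 ≤ f b) (hfm : Measurable f) (hfi : Integrable f β)
    (hf1 : ∫ b, f b ∂β = 1) : gπ β (⋃ n, gG β f n) = 1 := by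
  rw [measure_iUnion gG_disjoint (measurableSet_gG1 hfm), ← tsum_gr hf0 hfi hf1]
  congr 1; ext n
  have := gπ_G hf0 hfm hfi hf1 n MeasurableSet.univ
  simp only [Set.mem_univ, Set.ofPred_true, Set.inter_univ, Measure.restrict_univ] at this
  rw [this, lintegral_gα hfi hf1]

lemma gK_log (hf0 : ∀ b, 0 ≤ f b) (hfm : Measurable f) (hfi : Integrable f β)
    (hf1 : ∫ b, f b ∂β = 1) :
    ∫⁻ z, ENNReal.ofReal (log ((gK β f z : ℝ) + 1)) ∂(gπ β)
      ≤ 1 + ∫⁻ b, ENNReal.ofReal (InformationTheory.klFun (f b)) ∂β := by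
  have hU : (gπ β).restrict (⋃ n, gG β f n) = gπ β := by
    exact Measure.restrict_eq_self_of_ae_mem
      ((mem_ae_iff_prob_eq_one (MeasurableSet.iUnion (measurableSet_gG1 hfm))).2
        (gπ_iUnion hf0 hfm hfi hf1))
  rw [← hU, lintegral_iUnion (measurableSet_gG1 hfm) gG_disjoint]
  refine le_trans (le_of_eq ?_) (g_tsum_log hf0 hfi hf1)
  congr 1; ext n
  have h1 : ∫⁻ z in gG β f n, ENNReal.ofReal (log ((gK β f z : ℝ) + 1)) ∂(gπ β)
      = ∫⁻ z in gG β f n, ENNReal.ofReal (log ((n : ℝ) + 1)) ∂(gπ β) :=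
    setLIntegral_congr_fun (measurableSet_gG1 hfm n) fun z hz => by simp only [gK_of_mem hz]
  have h2 := gπ_G hf0 hfm hfi hf1 n MeasurableSet.univ
  simp only [Set.mem_univ, Set.ofPred_true, Set.inter_univ, Measure.restrict_univ] at h2
  rw [h1, setLIntegral_const, h2, lintegral_gα hfi hf1, mul_comm, ← ENNReal.ofReal_mul]
  linarith [gr_anti hfi hf1 (Nat.le_succ n)]

lemma measurable_gsel (hfm : Measurable f) : Measurable (fun z : ℕ → B × unitInterval => (z (gK β f z)).1) := by
  have h : Measurable (fun p : ℕ × (ℕ → B × unitInterval) => (p.2 p.1).1) :=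
    measurable_from_prod_countable_right fun n => measurable_fst.comp (measurable_pi_apply n)
  exact h.comp ((measurable_gK1 hfm).prodMk measurable_id)

lemma gsel_law (hf0 : ∀ b, 0 ≤ f b) (hfm : Measurable f) (hfi : Integrable f β)
    (hf1 : ∫ b, f b ∂β = 1) :
    (gπ β).map (fun z => (z (gK β f z)).1) = β.withDensity (fun b => ENNReal.ofReal (f b)) := by
  set P := (gπ β).map (fun z => (z (gK β f z)).1) with hP
  have hPp : IsProbabilityMeasure P := Measure.isProbabilityMeasure_map (measurable_gsel hfm).aemeasurable
  set N := Measure.sum (fun n => β.withDensity (fun b => ENNReal.ofReal (gα β f n b))) with hN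
  have hN1 : N Set.univ = 1 := by
    rw [hN, Measure.sum_apply _ MeasurableSet.univ, ← tsum_gr hf0 hfi hf1]
    congr 1; ext n
    rw [withDensity_apply _ MeasurableSet.univ, Measure.restrict_univ, lintegral_gα hfi hf1]
  have hNp : IsProbabilityMeasure N := ⟨hN1⟩
  have hF1 : (β.withDensity (fun b => ENNReal.ofReal (f b))) Set.univ = 1 := by
    rw [withDensity_apply _ MeasurableSet.univ, Measure.restrict_univ,
      ← ofReal_integral_eq_lintegral_ofReal hfi (ae_of_all _ hf0), hf1]
    simp
  have hFp : IsProbabilityMeasure (β.withDensity (fun b => ENNReal.ofReal (f b))) := ⟨hF1⟩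
  have e1 : N = P := by
    refine Measure.eq_of_le_of_isProbabilityMeasure (Measure.le_iff.2 fun C hC => ?_)
    rw [hP, Measure.map_apply (measurable_gsel hfm) hC, hN, Measure.sum_apply _ hC]
    have hms : ∀ n, MeasurableSet (gG β f n ∩ {z : ℕ → B × unitInterval | (z n).1 ∈ C}) := fun n =>
      (measurableSet_gG1 hfm n).inter ((measurable_fst.comp (measurable_pi_apply n)) hC)
    have : ∀ n, (β.withDensity (fun b => ENNReal.ofReal (gα β f n b))) C =
        gπ β (gG β f n ∩ {z | (z n).1 ∈ C}) := fun n => by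
      rw [withDensity_apply _ hC, gπ_G hf0 hfm hfi hf1 n hC]
    simp_rw [this]
    rw [← measure_iUnion _ hms]
    · refine measure_mono (Set.iUnion_subset fun n z hz => ?_)
      simp only [Set.mem_preimage, gK_of_mem hz.1]
      exact hz.2
    · exact fun i j hij => (gG_disjoint hij).mono Set.inter_subset_left Set.inter_subset_left
  have e2 : N = β.withDensity (fun b => ENNReal.ofReal (f b)) := by
    refine Measure.eq_of_le_of_isProbabilityMeasure ?_
    rw [hN, ← withDensity_tsum (fun n => (measurable_gα1 hfm n).ennreal_ofReal)]
    refine withDensity_mono (ae_of_all _ fun b => ?_)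
    rw [ENNReal.tsum_apply]
    refine ENNReal.tsum_le_of_sum_range_le fun n => ?_
    rw [← ENNReal.ofReal_sum_of_nonneg fun i _ => gα_nonneg i b, sum_gα hf0]
    exact ENNReal.ofReal_le_ofReal (min_le_left _ _)
  rw [← e1, e2]

end Sampler

section KLTools
open InformationTheory
variable {α γ : Type*} [MeasurableSpace α] [MeasurableSpace γ]

lemma klBits_eq (P Q : Measure α) [IsProbabilityMeasure P] [IsProbabilityMeasure Q] :
    klBits P Q = klDiv P Q / ENNReal.ofReal (log 2) := by
  have hL : 0 < log 2 := log_pos one_lt_two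
  have hi : Integrable (fun x => Real.logb 2 (P.rnDeriv Q x).toReal) P ↔ Integrable (llr P Q) P := by
    have : (fun x => Real.logb 2 (P.rnDeriv Q x).toReal) = fun x => llr P Q x / log 2 := rfl
    rw [this]
    refine ⟨fun h => ?_, fun h => h.div_const _⟩
    have := h.mul_const (log 2)
    simpa [div_mul_cancel₀ _ hL.ne'] using this
  unfold klBits
  by_cases h : P ≪ Q ∧ Integrable (llr P Q) P
  · rw [if_pos ⟨h.1, hi.2 h.2⟩, klDiv_of_ac_of_integrable h.1 h.2]
    have h3 : ∫ x, Real.logb 2 (P.rnDeriv Q x).toReal ∂P = (∫ x, llr P Q x ∂P) / log 2 := by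
      rw [← integral_div]; rfl
    rw [h3, ← ENNReal.ofReal_div_of_pos hL]
    simp
  · rw [if_neg (by rwa [hi])]
    have : klDiv P Q = ⊤ := by
      by_contra hne
      exact h (klDiv_ne_top_iff.1 hne)
    rw [this, ENNReal.top_div_of_ne_top ENNReal.ofReal_ne_top]

lemma klDiv_map_equiv (e : α ≃ᵐ γ) (P Q : Measure α) [IsFiniteMeasure P] [IsFiniteMeasure Q] :
    klDiv (P.map e) (Q.map e) = klDiv P Q := by
  refine le_antisymm (klDiv_map_le P Q e.measurable) ?_
  have := klDiv_map_le (P.map e) (Q.map e) e.symm.measurable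
  simpa [Measure.map_map e.symm.measurable e.measurable] using this

lemma klDiv_golden [StandardBorelSpace α] [Nonempty α] (P : Measure (α × γ)) [IsProbabilityMeasure P]
    (Q : Measure γ) [IsProbabilityMeasure Q] :
    klDiv P ((P.map Prod.fst).prod (P.map Prod.snd)) ≤ klDiv P ((P.map Prod.fst).prod Q) := by
  have : IsProbabilityMeasure (P.map Prod.fst) :=
    Measure.isProbabilityMeasure_map measurable_fst.aemeasurable
  have : IsProbabilityMeasure (P.map Prod.snd) :=
    Measure.isProbabilityMeasure_map measurable_snd.aemeasurable
  have : IsProbabilityMeasure (P.map Prod.swap) :=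
    Measure.isProbabilityMeasure_map measurable_swap.aemeasurable
  set P' := P.map Prod.swap with hP'
  have key : ∀ R : Measure γ, IsProbabilityMeasure R →
      klDiv P ((P.map Prod.fst).prod R) =
      klDiv P'.fst R + klDiv P' (P'.fst ⊗ₘ Kernel.const γ (P.map Prod.fst)) := by
    intro R hR
    rw [← klDiv_map_equiv MeasurableEquiv.prodComm P]
    have h1 : P.map (MeasurableEquiv.prodComm : α × γ ≃ᵐ γ × α) = P' := rfl
    have h2 : ((P.map Prod.fst).prod R).map (MeasurableEquiv.prodComm : α × γ ≃ᵐ γ × α) =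
        R ⊗ₘ Kernel.const γ (P.map Prod.fst) := by
      rw [Measure.compProd_const]; exact Measure.prod_swap
    rw [h1, h2]
    conv_lhs => rw [← P'.disintegrate P'.condKernel]
    rw [klDiv_compProd_eq_add, P'.disintegrate P'.condKernel]
  have hs : P'.fst = P.map Prod.snd := by
    rw [Measure.fst, hP', Measure.map_map measurable_fst measurable_swap]; rfl
  rw [key _ inferInstance, key _ inferInstance, hs, klDiv_self, zero_add]
  exact le_add_self

lemma klDiv_withDensity_eq (N : Measure α) [IsFiniteMeasure N] (h : α → ℝ≥0∞) (hh : Measurable h)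
    [IsFiniteMeasure (N.withDensity h)] :
    klDiv (N.withDensity h) N = ∫⁻ x, ENNReal.ofReal (klFun (h x).toReal) ∂N := by
  rw [klDiv_eq_lintegral_klFun_of_ac (withDensity_absolutelyContinuous _ _)]
  refine lintegral_congr_ae ?_
  filter_upwards [Measure.rnDeriv_withDensity N hh] with x hx
  rw [hx]

lemma klDiv_det (m : Measure α) [IsProbabilityMeasure m] (K : α → ℕ) (hK : Measurable K)
    (q : Measure ℕ) [IsProbabilityMeasure q] (hq : ∀ k, q {k} ≠ 0) :
    klDiv (m ⊗ₘ Kernel.deterministic K hK) (m ⊗ₘ Kernel.const α q)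
      = ∫⁻ s, ENNReal.ofReal (-log (q {K s}).toReal) ∂m := by
  set h : α × ℕ → ℝ≥0∞ := fun p => if p.2 = K p.1 then (q {p.2})⁻¹ else 0 with hh
  have hmeas : Measurable h := by
    refine Measurable.ite ?_ ?_ measurable_const
    · exact measurableSet_eq_fun measurable_snd (hK.comp measurable_fst)
    · exact ((measurable_of_countable (fun k : ℕ => q {k})).comp measurable_snd).inv
  have hd : m ⊗ₘ Kernel.deterministic K hK = (m ⊗ₘ Kernel.const α q).withDensity h := by
    refine Measure.ext_of_lintegral _ fun g hg => ?_
    rw [Measure.lintegral_compProd hg, lintegral_withDensity_eq_lintegral_mul _ hmeas hg,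
      Measure.lintegral_compProd (hmeas.mul hg)]
    refine lintegral_congr fun s => ?_
    rw [Kernel.lintegral_deterministic' (f := fun b => g (s, b)) _
      (hg.comp measurable_prodMk_left), Kernel.const_apply, lintegral_countable']
    rw [tsum_eq_single (K s)]
    · simp only [Pi.mul_apply, hh, if_pos]
      rw [mul_right_comm, ENNReal.inv_mul_cancel (hq _) (measure_ne_top _ _), one_mul]
    · intro k hk
      simp [hh, hk]
  have : IsFiniteMeasure ((m ⊗ₘ Kernel.const α q).withDensity h) := by rw [← hd]; infer_instance
  rw [hd, klDiv_withDensity_eq _ h hmeas, Measure.lintegral_compProd]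
  · refine lintegral_congr fun s => ?_
    rw [Kernel.const_apply, ← lintegral_add_compl _ (measurableSet_singleton (K s))]
    have h1 : ∫⁻ k in {K s}, ENNReal.ofReal (klFun (h (s, k)).toReal) ∂q =
        ENNReal.ofReal (klFun ((q {K s})⁻¹).toReal) * q {K s} := by
      rw [lintegral_singleton]; simp [hh]
    have h2 : ∫⁻ k in {K s}ᶜ, ENNReal.ofReal (klFun (h (s, k)).toReal) ∂q = 1 - q {K s} := by
      rw [← prob_compl_eq_one_sub (measurableSet_singleton _), ← setLIntegral_one]
      refine setLIntegral_congr_fun (measurableSet_singleton _).compl fun k hk => ?_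
      have : k ≠ K s := hk
      simp [hh, this, klFun_apply]
    rw [h1, h2]
    have hq0 : 0 < (q {K s}).toReal := ENNReal.toReal_pos (hq _) (measure_ne_top _ _)
    have hq1 : (q {K s}).toReal ≤ 1 := by
      have := ENNReal.toReal_mono ENNReal.one_ne_top (prob_le_one (μ := q) (s := {K s}))
      simpa using this
    have e : q {K s} = ENNReal.ofReal (q {K s}).toReal :=
      (ENNReal.ofReal_toReal (measure_ne_top _ _)).symm
    set t := (q {K s}).toReal with ht
    rw [e, ENNReal.toReal_inv, ENNReal.toReal_ofReal hq0.le, ← ENNReal.ofReal_mul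
      (klFun_nonneg (by positivity)), ← ENNReal.ofReal_one, ← ENNReal.ofReal_sub _ hq0.le,
      ← ENNReal.ofReal_add (mul_nonneg (klFun_nonneg (by positivity)) hq0.le) (by linarith)]
    congr 1
    rw [klFun_apply, log_inv]
    field_simp
    ring
  · have := measurable_klFun
    exact (this.comp hmeas.ennreal_toReal).ennreal_ofReal

end KLTools

lemma zeta_step (s t : ℝ) (hs : 0 < s) (ht : 1 < t) :
    t ^ (-(1 + s)) ≤ (1 / s) * ((t - 1) ^ (-s) - t ^ (-s)) := by
  have ht0 : 0 < t := by linarith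
  have ht1 : 0 < t - 1 := by linarith
  have h1 : t ^ (-(1 + s)) = t ^ (-s) * t⁻¹ := by
    rw [neg_add, add_comm, rpow_add ht0, rpow_neg_one]
  have h2 : (t - 1) ^ (-s) = t ^ (-s) * ((t - 1) / t) ^ (-s) := by
    rw [← mul_rpow ht0.le (by positivity)]
    congr 1; field_simp
  have h3 : 1 + s / t ≤ ((t - 1) / t) ^ (-s) := by
    rw [rpow_def_of_pos (by positivity)]
    have h4 := log_le_sub_one_of_pos (x := (t - 1) / t) (by positivity)
    have h5 := add_one_le_exp (log ((t - 1) / t) * -s)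
    have h6 : (t - 1) / t - 1 = -(1 / t) := by field_simp; ring
    rw [h6] at h4
    have h7 : s * (1 / t) ≤ s * (-log ((t - 1) / t)) := mul_le_mul_of_nonneg_left (by linarith) hs.le
    have h8 : s / t = s * (1 / t) := by ring
    linarith
  have hp : 0 < t ^ (-s) := rpow_pos_of_pos ht0 _
  rw [h1, h2]
  have : (1 / s) * (t ^ (-s) * ((t - 1) / t) ^ (-s) - t ^ (-s)) =
      t ^ (-s) * ((1 / s) * (((t - 1) / t) ^ (-s) - 1)) := by ring
  rw [this]
  refine mul_le_mul_of_nonneg_left ?_ hp.le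
  calc t⁻¹ = (1 / s) * (s / t) := by field_simp
    _ ≤ _ := mul_le_mul_of_nonneg_left (by linarith) (by positivity)

lemma zeta_sum (m : ℝ) (hm : 0 < m) (n : ℕ) :
    ∑ k ∈ Finset.range (n + 1), ((k : ℝ) + 1) ^ (-(1 + 1 / m)) ≤
      1 + m - m * ((n : ℝ) + 1) ^ (-(1 / m)) := by
  induction n with
  | zero => simp
  | succ n ih =>
    rw [Finset.sum_range_succ]
    have h := zeta_step (1 / m) ((n : ℝ) + 1 + 1) (by positivity) (by linarith [Nat.cast_nonneg (α := ℝ) n])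
    push_cast
    rw [one_div_one_div, add_sub_cancel_right] at h
    linarith

lemma exists_q (m : ℝ) (hm : 0 < m) : ∃ q : Measure ℕ, IsProbabilityMeasure q ∧
    ∀ k : ℕ, q {k} ≠ 0 ∧
      -log (q {k}).toReal ≤ (1 + 1 / m) * log ((k : ℝ) + 1) + log (1 + m) := by
  set f : ℕ → ℝ≥0∞ := fun k => ENNReal.ofReal (((k : ℝ) + 1) ^ (-(1 + 1 / m))) with hf
  have hpos : ∀ k : ℕ, 0 < ((k : ℝ) + 1) ^ (-(1 + 1 / m)) := fun k => by positivity
  have hle : ∑' k, f k ≤ ENNReal.ofReal (1 + m) := by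
    refine ENNReal.tsum_le_of_sum_range_le fun n => ?_
    refine (Finset.sum_le_sum_of_subset (Finset.range_mono (Nat.le_succ n))).trans ?_
    rw [← ENNReal.ofReal_sum_of_nonneg fun i _ => (hpos i).le]
    refine ENNReal.ofReal_le_ofReal ((zeta_sum m hm n).trans ?_)
    have : 0 < m * ((n : ℝ) + 1) ^ (-(1 / m)) := by positivity
    linarith
  have h0 : ∑' k, f k ≠ 0 := by
    intro h
    have := ENNReal.tsum_eq_zero.1 h 0
    simp [hf] at this
  have ht : ∑' k, f k ≠ ⊤ := ne_top_of_le_ne_top ENNReal.ofReal_ne_top hle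
  refine ⟨(PMF.normalize f h0 ht).toMeasure, inferInstance, fun k => ?_⟩
  rw [PMF.toMeasure_apply_singleton _ _ (measurableSet_singleton k), PMF.normalize_apply]
  have hq : ENNReal.ofReal (((k : ℝ) + 1) ^ (-(1 + 1 / m)) / (1 + m)) ≤ f k * (∑' k, f k)⁻¹ := by
    rw [ENNReal.ofReal_div_of_pos (by positivity), div_eq_mul_inv]
    gcongr
  have hfin : f k * (∑' k, f k)⁻¹ ≠ ⊤ :=
    ENNReal.mul_ne_top ENNReal.ofReal_ne_top (ENNReal.inv_ne_top.2 h0)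
  have hd : 0 < ((k : ℝ) + 1) ^ (-(1 + 1 / m)) / (1 + m) := div_pos (hpos k) (by positivity)
  have hr := (ENNReal.ofReal_le_iff_le_toReal hfin).1 hq
  refine ⟨fun h => ?_, ?_⟩
  · rw [h, ENNReal.toReal_zero] at hr; linarith
  · have h1 := log_le_log hd hr
    rw [log_div (hpos k).ne' (by positivity), log_rpow (by positivity)] at h1
    linarith

lemma sfr_numeric (d : ℝ) (hd : 0 ≤ d) :
    (1 + 1 / (d / log 2 + 3 / 2)) * (1 + d) + log (1 + (d / log 2 + 3 / 2))
      ≤ d + (log (d / log 2 + 1) + 4 * log 2) := by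
  have hL : 0.6931471803 < log 2 := log_two_gt_d9
  have hL0 : 0 < log 2 := by linarith
  set L := log 2 with hLd
  set m := d / L + 3 / 2 with hm
  have hm0 : 0 < m := by positivity
  have hLm : L * m = d + 3 / 2 * L := by rw [hm]; field_simp
  have h1 : (1 / m) * (1 + d) ≤ L := by
    rw [one_div, inv_mul_le_iff₀ hm0]; linarith
  have h2 : log (1 + m) ≤ log (5 / 2) + log (d / L + 1) := by
    rw [← log_mul (by norm_num) (by positivity)]
    refine log_le_log (by positivity) ?_
    have : 0 ≤ d / L := by positivity
    rw [hm]; linarith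
  have h3 : 2 * log (5 / 2) ≤ 3 * L := by
    have : log ((5 / 2) ^ 2) ≤ log (2 ^ 3) := log_le_log (by norm_num) (by norm_num)
    rw [log_pow, log_pow] at this
    exact_mod_cast this
  have h4 : (1 + 1 / m) * (1 + d) = (1 + d) + (1 / m) * (1 + d) := by ring
  rw [h4]
  linarith

section Core
open InformationTheory

/-- the space of the shared randomness -/
abbrev ZSp : Type := ℕ → unitInterval × unitInterval

def πZ : Measure ZSp := gπ (volume : Measure unitInterval)

instance : IsProbabilityMeasure πZ := by unfold πZ; infer_instance

lemma measurable_eval_pair : Measurable (fun p : ℕ × ZSp => (p.2 p.1).1) :=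
  measurable_from_prod_countable_right fun n => measurable_fst.comp (measurable_pi_apply n)

lemma map_withDensity_aux {S T : Type*} [MeasurableSpace S] [MeasurableSpace T] (v : Measure S)
    (φ : S → T) (hφ : Measurable φ) (h : T → ℝ≥0∞) (hh : Measurable h) :
    (v.withDensity (fun s => h (φ s))).map φ = (v.map φ).withDensity h := by
  ext C hC
  rw [Measure.map_apply hφ hC, withDensity_apply _ (hφ hC), withDensity_apply _ hC,
    setLIntegral_map hC hh hφ]

lemma sampler_slice {T : Type*} [MeasurableSpace T] (φ : unitInterval → T) (hφ : Measurable φ)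
    (h : T → ℝ≥0∞) (hh : Measurable h)
    (hp : IsProbabilityMeasure (((volume : Measure unitInterval).map φ).withDensity h)) :
    πZ.map (fun z => φ (z (gK volume (fun v => (h (φ v)).toReal) z)).1)
        = ((volume : Measure unitInterval).map φ).withDensity h ∧
    ∫⁻ z, ENNReal.ofReal (log ((gK volume (fun v => (h (φ v)).toReal) z : ℝ) + 1)) ∂πZ
      ≤ 1 + ∫⁻ y, ENNReal.ofReal (klFun (h y).toReal) ∂((volume : Measure unitInterval).map φ) := by
  set f : unitInterval → ℝ := fun v => (h (φ v)).toReal with hf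
  have hhφ : Measurable (fun v => h (φ v)) := hh.comp hφ
  have hfm : Measurable f := hhφ.ennreal_toReal
  have hl : ∫⁻ v, h (φ v) = 1 := by
    have := hp.measure_univ
    rw [withDensity_apply _ MeasurableSet.univ, Measure.restrict_univ, lintegral_map hh hφ] at this
    exact this
  have hfin : ∀ᵐ v, h (φ v) < ⊤ := ae_lt_top hhφ (by rw [hl]; exact ENNReal.one_ne_top)
  have hfi : Integrable f volume := integrable_toReal_of_lintegral_ne_top hhφ.aemeasurable
    (by rw [hl]; exact ENNReal.one_ne_top)
  have hf1 : ∫ v, f v = 1 := by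
    rw [hf, integral_toReal hhφ.aemeasurable hfin, hl]; simp
  have hf0 : ∀ v, 0 ≤ f v := fun v => ENNReal.toReal_nonneg
  constructor
  · have h1 := gsel_law hf0 hfm hfi hf1
    have h2 : πZ.map (fun z => φ (z (gK volume f z)).1) =
        ((gπ volume).map (fun z => (z (gK volume f z)).1)).map φ := by
      rw [Measure.map_map hφ (measurable_gsel hfm)]; rfl
    rw [h2, h1, ← map_withDensity_aux _ φ hφ h hh]
    congr 1
    refine withDensity_congr_ae ?_
    filter_upwards [hfin] with v hv
    exact ENNReal.ofReal_toReal hv.ne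
  · refine (gK_log hf0 hfm hfi hf1).trans (le_of_eq ?_)
    rw [lintegral_map _ hφ]
    exact (measurable_klFun.comp hh.ennreal_toReal).ennreal_ofReal

variable {𝒳 𝒰 𝒴 : Type*} [MeasurableSpace 𝒳] [MeasurableSpace 𝒰] [MeasurableSpace 𝒴]

lemma core_sampler [StandardBorelSpace 𝒴] [Nonempty 𝒴] (ρ : Measure (𝒳 × 𝒰)) [IsProbabilityMeasure ρ] (κ : Kernel (𝒳 × 𝒰) 𝒴)
    [IsMarkovKernel κ] (c : Kernel 𝒰 𝒴) [IsMarkovKernel c]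
    (hD : klDiv (ρ ⊗ₘ κ) (ρ ⊗ₘ c.prodMkLeft 𝒳) ≠ ⊤) :
    ∃ (φ : 𝒰 × unitInterval → 𝒴) (k : (𝒳 × 𝒰) × ZSp → ℕ), Measurable φ ∧ Measurable k ∧
      (∀ᵐ a ∂ρ, πZ.map (fun z => φ (a.2, (z (k (a, z))).1)) = κ a) ∧
      ∫⁻ p, ENNReal.ofReal (log ((k p : ℝ) + 1)) ∂(ρ.prod πZ)
        ≤ 1 + klDiv (ρ ⊗ₘ κ) (ρ ⊗ₘ c.prodMkLeft 𝒳) := by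
  obtain ⟨φ0, hφ0, hφc⟩ := Kernel.exists_measurable_map_eq_unitInterval c
  set η := c.prodMkLeft 𝒳 with hη
  set h : 𝒳 × 𝒰 → 𝒴 → ℝ≥0∞ := κ.rnDeriv η with hh
  have hhm : Measurable (Function.uncurry h) := Kernel.measurable_rnDeriv κ η
  have hac : ρ ⊗ₘ κ ≪ ρ ⊗ₘ η := (klDiv_ne_top_iff.1 hD).1
  have hκ_eq : ∀ᵐ a ∂ρ, κ a = η.withDensity h a := by
    filter_upwards [hac.kernel_of_compProd] with a ha using (Kernel.withDensity_rnDeriv_eq ha).symm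
  have hηa : ∀ a, η a = volume.map (φ0 a.2) := fun a => by
    rw [hη, Kernel.prodMkLeft_apply, hφc]
  have hDeq : klDiv (ρ ⊗ₘ κ) (ρ ⊗ₘ η) =
      ∫⁻ a, ∫⁻ y, ENNReal.ofReal (klFun (h a y).toReal) ∂(η a) ∂ρ := by
    have e : ρ ⊗ₘ κ = (ρ ⊗ₘ η).withDensity (Function.uncurry h) := by
      rw [Measure.compProd_congr hκ_eq, Measure.compProd_withDensity hhm]; rfl
    have : IsFiniteMeasure ((ρ ⊗ₘ η).withDensity (Function.uncurry h)) := by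
      rw [← e]; infer_instance
    rw [e, klDiv_withDensity_eq _ _ hhm, Measure.lintegral_compProd]
    · rfl
    · exact (measurable_klFun.comp hhm.ennreal_toReal).ennreal_ofReal
  set F : 𝒳 × 𝒰 → unitInterval → ℝ := fun a v => (h a (φ0 a.2 v)).toReal with hF
  have hFm : Measurable (Function.uncurry F) := by
    have : Measurable (fun p : (𝒳 × 𝒰) × unitInterval => (p.1, φ0 p.1.2 p.2)) :=
      measurable_fst.prodMk
        (hφ0.comp ((measurable_snd.comp measurable_fst).prodMk measurable_snd))
    exact (hhm.comp this).ennreal_toReal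
  have hkm : Measurable (fun p : (𝒳 × 𝒰) × ZSp => gK volume (F p.1) p.2) := measurable_gK hFm
  have hslice : ∀ᵐ a ∂ρ, πZ.map (fun z => φ0 a.2 (z (gK volume (F a) z)).1) = κ a ∧
      ∫⁻ z, ENNReal.ofReal (log ((gK volume (F a) z : ℝ) + 1)) ∂πZ
        ≤ 1 + ∫⁻ y, ENNReal.ofReal (klFun (h a y).toReal) ∂(η a) := by
    filter_upwards [hκ_eq] with a ha
    rw [Kernel.withDensity_apply _ hhm, hηa] at ha
    have hp : IsProbabilityMeasure ((volume.map (φ0 a.2)).withDensity (h a)) := by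
      rw [← ha]; infer_instance
    have := sampler_slice (φ0 a.2) (hφ0.comp measurable_prodMk_left) (h a)
      (hhm.comp measurable_prodMk_left) hp
    rw [ha, hηa]
    exact this
  refine ⟨Function.uncurry φ0, fun p => gK volume (F p.1) p.2, hφ0, hkm, ?_, ?_⟩
  · filter_upwards [hslice] with a ha using ha.1
  · rw [lintegral_prod _ (Measurable.aemeasurable ?_), hDeq]
    · calc _ ≤ ∫⁻ a, 1 + ∫⁻ y, ENNReal.ofReal (klFun (h a y).toReal) ∂(η a) ∂ρ := by
            refine lintegral_mono_ae ?_
            filter_upwards [hslice] with a ha using ha.2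
        _ = _ := by
            rw [lintegral_add_left measurable_const]; simp
    · exact (measurable_log.comp
        (((measurable_of_countable (fun n : ℕ => (n : ℝ))).comp hkm).add_const 1)).ennreal_ofReal

/-- the output triple map -/
def outMap (φ : 𝒰 × unitInterval → 𝒴) (k : (𝒳 × 𝒰) × ZSp → ℕ) (p : (𝒳 × 𝒰) × ZSp) :
    𝒳 × (ZSp × (𝒴 × 𝒰)) :=
  (p.1.1, (p.2, (φ (p.1.2, (p.2 (k p)).1), p.1.2)))

lemma measurable_outMap {φ : 𝒰 × unitInterval → 𝒴} {k : (𝒳 × 𝒰) × ZSp → ℕ} (hφ : Measurable φ)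
    (hk : Measurable k) : Measurable (outMap φ k) := by
  have h1 : Measurable (fun p : (𝒳 × 𝒰) × ZSp => (p.2 (k p)).1) :=
    measurable_eval_pair.comp (hk.prodMk measurable_snd)
  have h2 : Measurable (fun p : (𝒳 × 𝒰) × ZSp => φ (p.1.2, (p.2 (k p)).1)) :=
    hφ.comp ((measurable_snd.comp measurable_fst).prodMk h1)
  exact (measurable_fst.comp measurable_fst).prodMk (measurable_snd.prodMk
    (h2.prodMk (measurable_snd.comp measurable_fst)))

lemma core_bound [StandardBorelSpace 𝒳] [Nonempty 𝒳] (ρ : Measure (𝒳 × 𝒰)) [IsProbabilityMeasure ρ]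
    (φ : 𝒰 × unitInterval → 𝒴) (k : (𝒳 × 𝒰) × ZSp → ℕ) (hφ : Measurable φ) (hk : Measurable k)
    (q : Measure ℕ) [IsProbabilityMeasure q] (hq : ∀ k, q {k} ≠ 0) :
    klDiv ((ρ.prod πZ).map (outMap φ k))
        ((((ρ.prod πZ).map (outMap φ k)).map Prod.fst).prod
          (((ρ.prod πZ).map (outMap φ k)).map Prod.snd))
      ≤ klDiv ρ ((ρ.map Prod.fst).prod (ρ.map Prod.snd))
        + ∫⁻ p, ENNReal.ofReal (-log (q {k p}).toReal) ∂(ρ.prod πZ) := by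
  set M := (ρ.prod πZ).map (outMap φ k) with hM
  have hom := measurable_outMap hφ hk
  have : IsProbabilityMeasure M := Measure.isProbabilityMeasure_map hom.aemeasurable
  have i1 : IsProbabilityMeasure (ρ.map Prod.fst) :=
    Measure.isProbabilityMeasure_map measurable_fst.aemeasurable
  have i2 : IsProbabilityMeasure (ρ.map Prod.snd) :=
    Measure.isProbabilityMeasure_map measurable_snd.aemeasurable
  have hM1 : M.map Prod.fst = ρ.map Prod.fst := by
    rw [hM, Measure.map_map measurable_fst hom]
    have : (Prod.fst ∘ outMap φ k) = Prod.fst ∘ (Prod.fst : (𝒳 × 𝒰) × ZSp → 𝒳 × 𝒰) := rfl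
    rw [this, ← Measure.map_map measurable_fst measurable_fst, Measure.map_fst_prod]
    simp
  set G : ((𝒳 × 𝒰) × ZSp) × ℕ → 𝒳 × (ZSp × (𝒴 × 𝒰)) := fun p =>
    (p.1.1.1, (p.1.2, (φ (p.1.1.2, (p.1.2 p.2).1), p.1.1.2))) with hG
  have hGm : Measurable G := by
    have h1 : Measurable (fun p : ((𝒳 × 𝒰) × ZSp) × ℕ => (p.1.2 p.2).1) :=
      measurable_eval_pair.comp (measurable_snd.prodMk (measurable_snd.comp measurable_fst))
    have h3 : Measurable (fun p : ((𝒳 × 𝒰) × ZSp) × ℕ => p.1.1.2) := by fun_prop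
    have h2 : Measurable (fun p : ((𝒳 × 𝒰) × ZSp) × ℕ => φ (p.1.1.2, (p.1.2 p.2).1)) :=
      hφ.comp (h3.prodMk h1)
    have h4 : Measurable (fun p : ((𝒳 × 𝒰) × ZSp) × ℕ => p.1.1.1) := by fun_prop
    have h5 : Measurable (fun p : ((𝒳 × 𝒰) × ZSp) × ℕ => p.1.2) := by fun_prop
    exact h4.prodMk (h5.prodMk (h2.prodMk h3))
  set H : (𝒰 × ZSp) × ℕ → ZSp × (𝒴 × 𝒰) := fun p =>
    (p.1.2, (φ (p.1.1, (p.1.2 p.2).1), p.1.1)) with hH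
  have hHm : Measurable H := by
    have h1 : Measurable (fun p : (𝒰 × ZSp) × ℕ => (p.1.2 p.2).1) :=
      measurable_eval_pair.comp (measurable_snd.prodMk (measurable_snd.comp measurable_fst))
    have h3 : Measurable (fun p : (𝒰 × ZSp) × ℕ => p.1.1) := by fun_prop
    have h2 : Measurable (fun p : (𝒰 × ZSp) × ℕ => φ (p.1.1, (p.1.2 p.2).1)) :=
      hφ.comp (h3.prodMk h1)
    have h5 : Measurable (fun p : (𝒰 × ZSp) × ℕ => p.1.2) := by fun_prop
    exact h5.prodMk (h2.prodMk h3)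
  set Q : Measure (ZSp × (𝒴 × 𝒰)) := (((ρ.map Prod.snd).prod πZ).prod q).map H with hQ
  have i3 : IsProbabilityMeasure Q := Measure.isProbabilityMeasure_map hHm.aemeasurable
  set J := (ρ.prod πZ) ⊗ₘ Kernel.deterministic k hk with hJ
  set N := (((ρ.map Prod.fst).prod (ρ.map Prod.snd)).prod πZ) ⊗ₘ Kernel.const _ q with hN
  have hJM : J.map G = M := by
    refine Measure.ext_of_lintegral _ fun g hg => ?_
    rw [lintegral_map hg hGm, hJ, Measure.lintegral_compProd (f := fun p => g (G p)) (hg.comp hGm), hM, lintegral_map hg hom]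
    refine lintegral_congr fun p => ?_
    rw [Kernel.lintegral_deterministic' (f := fun b => g (G (p, b))) _
      ((hg.comp hGm).comp measurable_prodMk_left)]
    rfl
  have hNQ : N.map G = (ρ.map Prod.fst).prod Q := by
    refine Measure.ext_of_lintegral _ fun g hg => ?_
    have m1 : Measurable (fun p : ((𝒳 × 𝒰) × ZSp) × ℕ => g (G p)) := hg.comp hGm
    rw [lintegral_map hg hGm, hN, Measure.compProd_const, lintegral_prod _ m1.aemeasurable,
      lintegral_prod _ (m1.lintegral_prod_right').aemeasurable,
      lintegral_prod _ ((m1.lintegral_prod_right').lintegral_prod_right').aemeasurable,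
      lintegral_prod _ hg.aemeasurable]
    refine lintegral_congr fun x => ?_
    have m2 : Measurable (fun p : ZSp × (𝒴 × 𝒰) => g (x, p)) := hg.comp measurable_prodMk_left
    have m3 : Measurable (fun p : (𝒰 × ZSp) × ℕ => g (x, H p)) := m2.comp hHm
    rw [hQ, lintegral_map m2 hHm, lintegral_prod _ m3.aemeasurable,
      lintegral_prod _ (m3.lintegral_prod_right').aemeasurable]
  calc klDiv M ((M.map Prod.fst).prod (M.map Prod.snd))
      ≤ klDiv M ((M.map Prod.fst).prod Q) := klDiv_golden M Q
    _ = klDiv (J.map G) (N.map G) := by rw [hJM, hNQ, hM1]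
    _ ≤ klDiv J N := klDiv_map_le J N hGm
    _ = klDiv (ρ.prod πZ) (((ρ.map Prod.fst).prod (ρ.map Prod.snd)).prod πZ)
        + klDiv J ((ρ.prod πZ) ⊗ₘ Kernel.const _ q) := klDiv_compProd_eq_add _ _ _ _
    _ = _ := by
        rw [hJ, klDiv_det _ k hk q hq, ← Measure.compProd_const, ← Measure.compProd_const,
          klDiv_compProd_left, Measure.compProd_const]

lemma core_chain (PX : Measure 𝒳) [IsProbabilityMeasure PX] (PU : Measure 𝒰)
    [IsProbabilityMeasure PU] (ρ : Measure (𝒳 × 𝒰)) [IsProbabilityMeasure ρ]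
    (κ : Kernel (𝒳 × 𝒰) 𝒴) [IsMarkovKernel κ] (c : Kernel 𝒰 𝒴) [IsMarkovKernel c]
    (P : Measure (𝒳 × (𝒴 × 𝒰))) (PYU : Measure (𝒴 × 𝒰)) [IsProbabilityMeasure PYU]
    (hP : P = (ρ ⊗ₘ κ).map (fun p => (p.1.1, (p.2, p.1.2))))
    (hPYU : PYU = (PU ⊗ₘ c).map Prod.swap) :
    klDiv P (PX.prod PYU) = klDiv ρ (PX.prod PU) + klDiv (ρ ⊗ₘ κ) (ρ ⊗ₘ c.prodMkLeft 𝒳) := by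
  rw [← klDiv_compProd_eq_add]
  let e : (𝒳 × 𝒰) × 𝒴 ≃ᵐ 𝒳 × (𝒴 × 𝒰) :=
    { toFun := fun p => (p.1.1, (p.2, p.1.2))
      invFun := fun p => ((p.1, p.2.2), p.2.1)
      left_inv := fun _ => rfl
      right_inv := fun _ => rfl
      measurable_toFun := by dsimp; fun_prop
      measurable_invFun := by dsimp; fun_prop }
  have he : ∀ p, e p = (p.1.1, (p.2, p.1.2)) := fun _ => rfl
  have h1 : P = (ρ ⊗ₘ κ).map e := hP
  have h2 : PX.prod PYU = ((PX.prod PU) ⊗ₘ c.prodMkLeft 𝒳).map e := by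
    refine Measure.ext_of_lintegral _ fun g hg => ?_
    have hge : Measurable (fun p => g (e p)) := hg.comp e.measurable
    rw [lintegral_map hg e.measurable, Measure.lintegral_compProd hge,
      lintegral_prod _ hg.aemeasurable, lintegral_prod _
      (Measurable.lintegral_kernel_prod_right' hge).aemeasurable]
    refine lintegral_congr fun x => ?_
    have m2 : Measurable (fun p : 𝒴 × 𝒰 => g (x, p)) := hg.comp measurable_prodMk_left
    have m3 : Measurable (fun p : 𝒰 × 𝒴 => g (x, p.swap)) := m2.comp measurable_swap
    rw [hPYU, lintegral_map m2 measurable_swap, Measure.lintegral_compProd m3]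
    rfl
  rw [h1, h2, klDiv_map_equiv]

end Core

section Assembly
open InformationTheory

lemma sampled_law {A T W : Type*} [MeasurableSpace A] [MeasurableSpace T] [MeasurableSpace W]
    (ρ : Measure A) [SFinite ρ] (ν : Measure W) [SFinite ν] (κ : Kernel A T) [IsSFiniteKernel κ]
    (g : A × W → T) (hg : Measurable g) (hl : ∀ᵐ a ∂ρ, ν.map (fun z => g (a, z)) = κ a) :
    (ρ.prod ν).map (fun p => (p.1, g p)) = ρ ⊗ₘ κ := by
  refine Measure.ext_of_lintegral _ fun f hf => ?_
  have m1 : Measurable (fun p : A × W => f (p.1, g p)) := hf.comp (measurable_fst.prodMk hg)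
  rw [lintegral_map hf (measurable_fst.prodMk hg), lintegral_prod _ m1.aemeasurable,
    Measure.lintegral_compProd hf]
  refine lintegral_congr_ae ?_
  filter_upwards [hl] with a ha
  have m2 : Measurable (fun t => f (a, t)) := hf.comp measurable_prodMk_left
  have m3 : Measurable (fun z => g (a, z)) := hg.comp measurable_prodMk_left
  rw [← ha, lintegral_map m2 m3]

lemma assemble {Ω 𝒰 𝒳 𝒴 : Type*} [MeasurableSpace Ω]
    [MeasurableSpace 𝒰] [MeasurableSpace 𝒳] [MeasurableSpace 𝒴]
    [StandardBorelSpace 𝒰] [StandardBorelSpace 𝒳] [StandardBorelSpace 𝒴]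
    [Nonempty 𝒰] [Nonempty 𝒳] [Nonempty 𝒴]
    (μ : Measure Ω) [IsProbabilityMeasure μ]
    (U : Ω → 𝒰) (X : Ω → 𝒳) (Y : Ω → 𝒴)
    (hU : Measurable U) (hX : Measurable X) (hY : Measurable Y)
    (g : (𝒳 × 𝒰) × ZSp → 𝒴) (hg : Measurable g)
    (hl : ∀ᵐ a ∂(μ.map (fun ω => (X ω, U ω))),
      πZ.map (fun z => g (a, z)) = condDistrib Y (fun ω => (X ω, U ω)) μ a)
    (M : Measure (𝒳 × (ZSp × (𝒴 × 𝒰))))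
    (hM : M = ((μ.map (fun ω => (X ω, U ω))).prod πZ).map
      (fun p => (p.1.1, (p.2, (g p, p.1.2)))))
    (B : ℝ≥0∞)
    (hB : klBits M ((M.map Prod.fst).prod (M.map Prod.snd)) - miBits μ X (fun ω => (Y ω, U ω)) ≤ B) :
    ∃ (Ω' : Type) (_ : MeasurableSpace Ω') (μ' : Measure Ω') (_ : IsProbabilityMeasure μ')
      (𝒵 : Type) (_ : MeasurableSpace 𝒵)
      (U' : Ω' → 𝒰) (X' : Ω' → 𝒳) (Y' : Ω' → 𝒴) (Z : Ω' → 𝒵),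
      Measurable U' ∧ Measurable X' ∧ Measurable Y' ∧ Measurable Z ∧
      μ'.map (fun ω => (U' ω, X' ω, Y' ω)) = μ.map (fun ω => (U ω, X ω, Y ω)) ∧
      IndepFun (fun ω => (X' ω, U' ω)) Z μ' ∧
      (∃ g : 𝒳 × 𝒵 × 𝒰 → 𝒴, Measurable g ∧ Y' =ᵐ[μ'] fun ω => g (X' ω, Z ω, U' ω)) ∧
      cmiBits μ' X' Z (fun ω => (Y' ω, U' ω)) ≤ B := by
  have hXU : Measurable (fun ω => (X ω, U ω)) := hX.prodMk hU
  set ρ := μ.map (fun ω => (X ω, U ω)) with hρ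
  have iρ : IsProbabilityMeasure ρ := Measure.isProbabilityMeasure_map hXU.aemeasurable
  obtain ⟨e, he, hel⟩ : ∃ e : unitInterval → 𝒳 × 𝒰, Measurable e ∧
      (volume : Measure unitInterval).map e = ρ := by
    obtain ⟨e, he, hel⟩ := Kernel.exists_measurable_map_eq_unitInterval (Kernel.const Unit ρ)
    exact ⟨e (), he.comp measurable_prodMk_left, hel ()⟩
  have hlaw := sampled_law ρ πZ _ g hg hl
  rw [hρ, compProd_map_condDistrib hY.aemeasurable, ← hρ] at hlaw
  set E : unitInterval × ZSp → (𝒳 × 𝒰) × ZSp := fun ω => (e ω.1, ω.2) with hE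
  have hEm : Measurable E := (he.comp measurable_fst).prodMk measurable_snd
  have hEl : ((volume : Measure unitInterval).prod πZ).map E = ρ.prod πZ := by
    have := Measure.map_prod_map (volume : Measure unitInterval) πZ he measurable_id
    rw [Measure.map_id, hel] at this
    rw [this]; rfl
  have hlaw' : ((volume : Measure unitInterval).prod πZ).map (fun ω => (e ω.1, g (E ω))) =
      μ.map (fun ω => ((X ω, U ω), Y ω)) := by
    rw [← hlaw, ← hEl, Measure.map_map (measurable_fst.prodMk hg) hEm]; rfl
  have hm1 : Measurable (fun ω => (e ω.1, g (E ω))) :=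
    (he.comp measurable_fst).prodMk (hg.comp hEm)
  have hm2 : Measurable (fun ω => ((X ω, U ω), Y ω)) := hXU.prodMk hY
  have hM' : ((volume : Measure unitInterval).prod πZ).map
      (fun ω => ((e ω.1).1, (ω.2, (g (E ω), (e ω.1).2)))) = M := by
    rw [hM, ← hEl, Measure.map_map (by fun_prop) hEm]; rfl
  have hm3 : Measurable (fun ω : unitInterval × ZSp =>
      ((e ω.1).1, (ω.2, (g (E ω), (e ω.1).2)))) := by fun_prop
  refine ⟨unitInterval × ZSp, inferInstance, volume.prod πZ, inferInstance, ZSp, inferInstance,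
    fun ω => (e ω.1).2, fun ω => (e ω.1).1, fun ω => g (E ω), fun ω => ω.2,
    by fun_prop, by fun_prop, by fun_prop, by fun_prop, ?_, ?_, ?_, ?_⟩
  · have h : Measurable (fun p : (𝒳 × 𝒰) × 𝒴 => (p.1.2, p.1.1, p.2)) := by fun_prop
    have := congrArg (Measure.map (fun p : (𝒳 × 𝒰) × 𝒴 => (p.1.2, p.1.1, p.2))) hlaw'
    rw [Measure.map_map h hm1, Measure.map_map h hm2] at this
    exact this
  · exact indepFun_prod he measurable_id
  · refine ⟨fun p => g ((p.1, p.2.2), p.2.1), by fun_prop, ?_⟩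
    exact Filter.EventuallyEq.rfl
  · refine le_trans (le_of_eq ?_) hB
    unfold cmiBits
    congr 1
    · unfold miBits
      rw [hM']
      congr 2
      · rw [← hM', Measure.map_map measurable_fst hm3]; rfl
      · rw [← hM', Measure.map_map measurable_snd hm3]; rfl
    · have h : Measurable (fun p : (𝒳 × 𝒰) × 𝒴 => (p.1.1, (p.2, p.1.2))) := by fun_prop
      have h1 := congrArg (Measure.map (fun p : (𝒳 × 𝒰) × 𝒴 => (p.1.1, (p.2, p.1.2)))) hlaw'
      rw [Measure.map_map h hm1, Measure.map_map h hm2] at h1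
      have h2 := congrArg (Measure.map (fun p : (𝒳 × 𝒰) × 𝒴 => p.1.1)) hlaw'
      rw [Measure.map_map (by fun_prop) hm1, Measure.map_map (by fun_prop) hm2] at h2
      have h3 := congrArg (Measure.map (fun p : (𝒳 × 𝒰) × 𝒴 => (p.2, p.1.2))) hlaw'
      rw [Measure.map_map (by fun_prop) hm1, Measure.map_map (by fun_prop) hm2] at h3
      unfold miBits
      exact congrArg₂ klBits h1 (congrArg₂ Measure.prod h2 h3)

end Assembly

section Final
open InformationTheory

lemma πZ_zero : πZ.map (fun z : ZSp => (z 0).1) = (volume : Measure unitInterval) := by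
  have : (fun z : ZSp => (z 0).1) = Prod.fst ∘ (fun z : ZSp => z 0) := rfl
  rw [this, ← Measure.map_map measurable_fst (measurable_pi_apply 0), πZ, gπ,
    Measure.infinitePi_map_eval, gν, Measure.map_fst_prod]
  simp

lemma final_calc (I0 D W : ℝ≥0∞) (hI : I0 ≠ ⊤) (hD : D ≠ ⊤)
    (m : ℝ) (hm : m = D.toReal / log 2 + 3 / 2)
    (hW : W ≤ ENNReal.ofReal (1 + 1 / m) * (1 + D) + ENNReal.ofReal (log (1 + m))) :
    (I0 + W) / ENNReal.ofReal (log 2) - (I0 + D) / ENNReal.ofReal (log 2) ≤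
      ENNReal.ofReal (Real.logb 2 (((I0 + D) / ENNReal.ofReal (log 2)
        - I0 / ENNReal.ofReal (log 2)).toReal + 1) + 4) := by
  have hl : 0 < log 2 := log_pos (by norm_num)
  have hL0 : ENNReal.ofReal (log 2) ≠ 0 := by simpa using hl
  have hLt : ENNReal.ofReal (log 2) ≠ ⊤ := ENNReal.ofReal_ne_top
  set L := ENNReal.ofReal (log 2) with hL
  set d := D.toReal with hd
  have hd0 : 0 ≤ d := ENNReal.toReal_nonneg
  have hDd : D = ENNReal.ofReal d := (ENNReal.ofReal_toReal hD).symm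
  have hcm : (I0 + D) / L - I0 / L = D / L := by
    rw [ENNReal.add_div, ENNReal.add_sub_cancel_left (ENNReal.div_ne_top hI hL0)]
  have hcr : (D / L).toReal = d / log 2 := by
    rw [ENNReal.toReal_div, hL, ENNReal.toReal_ofReal hl.le]
  rw [hcm, hcr]
  have hm0 : 0 < m := by rw [hm]; positivity
  have hpos : 0 ≤ log (d / log 2 + 1) + 4 * log 2 := by
    have : 0 ≤ log (d / log 2 + 1) := log_nonneg (by have := div_nonneg hd0 hl.le; linarith)
    positivity
  have hW2 : W ≤ D + ENNReal.ofReal (log (d / log 2 + 1) + 4 * log 2) := by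
    refine hW.trans ?_
    have h1 : (1 : ℝ≥0∞) + D = ENNReal.ofReal (1 + d) := by
      rw [ENNReal.ofReal_add zero_le_one hd0, ← hDd]; simp
    have h2 : 0 ≤ log (1 + m) := log_nonneg (by linarith)
    rw [h1, ← ENNReal.ofReal_mul (by positivity), ← ENNReal.ofReal_add (by positivity) h2, hDd,
      ← ENNReal.ofReal_add hd0 hpos]
    refine ENNReal.ofReal_le_ofReal ?_
    rw [hm]
    exact sfr_numeric d hd0
  rw [tsub_le_iff_left]
  calc (I0 + W) / L ≤ (I0 + (D + ENNReal.ofReal (log (d / log 2 + 1) + 4 * log 2))) / L := by gcongr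
    _ = (I0 + D) / L + ENNReal.ofReal (log (d / log 2 + 1) + 4 * log 2) / L := by
        rw [← add_assoc, ENNReal.add_div]
    _ = _ := by
        rw [hL, ← ENNReal.ofReal_div_of_pos hl]
        congr 2
        rw [Real.logb]
        field_simp

lemma main_aux {Ω 𝒰 𝒳 𝒴 : Type*} [MeasurableSpace Ω]
    [MeasurableSpace 𝒰] [MeasurableSpace 𝒳] [MeasurableSpace 𝒴]
    [StandardBorelSpace 𝒰] [StandardBorelSpace 𝒳] [StandardBorelSpace 𝒴]
    [Nonempty 𝒰] [Nonempty 𝒳] [Nonempty 𝒴]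
    (μ : Measure Ω) [IsProbabilityMeasure μ]
    (U : Ω → 𝒰) (X : Ω → 𝒳) (Y : Ω → 𝒴)
    (hU : Measurable U) (hX : Measurable X) (hY : Measurable Y) :
    ∃ g : (𝒳 × 𝒰) × ZSp → 𝒴, Measurable g ∧
    (∀ᵐ a ∂(μ.map (fun ω => (X ω, U ω))),
      πZ.map (fun z => g (a, z)) = condDistrib Y (fun ω => (X ω, U ω)) μ a) ∧
    ∃ M : Measure (𝒳 × (ZSp × (𝒴 × 𝒰))), M = ((μ.map (fun ω => (X ω, U ω))).prod πZ).map
      (fun p => (p.1.1, (p.2, (g p, p.1.2)))) ∧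
    klBits M ((M.map Prod.fst).prod (M.map Prod.snd)) - miBits μ X (fun ω => (Y ω, U ω)) ≤
        ENNReal.ofReal (Real.logb 2 ((cmiBits μ X Y U).toReal + 1) + 4) := by
  have hXU : Measurable (fun ω => (X ω, U ω)) := hX.prodMk hU
  have hYU : Measurable (fun ω => (Y ω, U ω)) := hY.prodMk hU
  have hXYU : Measurable (fun ω => (X ω, (Y ω, U ω))) := hX.prodMk hYU
  have ip1 : IsProbabilityMeasure (μ.map X) := Measure.isProbabilityMeasure_map hX.aemeasurable
  have ip2 : IsProbabilityMeasure (μ.map U) := Measure.isProbabilityMeasure_map hU.aemeasurable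
  have ip3 : IsProbabilityMeasure (μ.map (fun ω => (Y ω, U ω))) :=
    Measure.isProbabilityMeasure_map hYU.aemeasurable
  have ip4 : IsProbabilityMeasure (μ.map (fun ω => (X ω, (Y ω, U ω)))) :=
    Measure.isProbabilityMeasure_map hXYU.aemeasurable
  have ip5 : IsProbabilityMeasure (μ.map (fun ω => (X ω, U ω))) :=
    Measure.isProbabilityMeasure_map hXU.aemeasurable
  have hmiXU : miBits μ X U = klDiv (μ.map (fun ω => (X ω, U ω))) ((μ.map X).prod (μ.map U))
      / ENNReal.ofReal (log 2) := klBits_eq _ _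
  have hmiXYU : miBits μ X (fun ω => (Y ω, U ω)) =
      klDiv (μ.map (fun ω => (X ω, (Y ω, U ω)))) ((μ.map X).prod (μ.map (fun ω => (Y ω, U ω))))
      / ENNReal.ofReal (log 2) := klBits_eq _ _
  have hchain := core_chain (μ.map X) (μ.map U) (μ.map (fun ω => (X ω, U ω)))
    (condDistrib Y (fun ω => (X ω, U ω)) μ) (condDistrib Y U μ)
    (μ.map (fun ω => (X ω, (Y ω, U ω)))) (μ.map (fun ω => (Y ω, U ω)))
    (by
      rw [compProd_map_condDistrib hY.aemeasurable, Measure.map_map (by fun_prop) (hXU.prodMk hY)]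
      rfl)
    (by
      rw [compProd_map_condDistrib hY.aemeasurable,
        Measure.map_map measurable_swap (hU.prodMk hY)]
      rfl)
  have hfst : (μ.map (fun ω => (X ω, U ω))).map Prod.fst = μ.map X := by
    rw [Measure.map_map measurable_fst hXU]; rfl
  have hsnd : (μ.map (fun ω => (X ω, U ω))).map Prod.snd = μ.map U := by
    rw [Measure.map_map measurable_snd hXU]; rfl
  have hl : 0 < log 2 := log_pos (by norm_num)
  have hL0 : ENNReal.ofReal (log 2) ≠ 0 := by simpa using hl
  set ρ := μ.map (fun ω => (X ω, U ω)) with hρ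
  set κ := condDistrib Y (fun ω => (X ω, U ω)) μ with hκ
  set c := condDistrib Y U μ with hc
  set I0 := klDiv ρ ((μ.map X).prod (μ.map U)) with hI0
  set D := klDiv (ρ ⊗ₘ κ) (ρ ⊗ₘ c.prodMkLeft 𝒳) with hD
  rw [hchain] at hmiXYU
  by_cases htop : I0 + D = ⊤
  · obtain ⟨f, hf, hfl⟩ := Kernel.exists_measurable_map_eq_unitInterval κ
    have hz : Measurable (fun z : ZSp => (z 0).1) := measurable_fst.comp (measurable_pi_apply 0)
    refine ⟨fun p => f p.1 (p.2 0).1,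
      hf.comp (measurable_fst.prodMk (hz.comp measurable_snd)), ?_, _, rfl, ?_⟩
    · refine Filter.Eventually.of_forall fun a => ?_
      have hfa : Measurable (f a) := hf.comp measurable_prodMk_left
      rw [← hfl a, ← πZ_zero, Measure.map_map hfa hz]
      rfl
    · rw [hmiXYU, htop, ENNReal.top_div_of_ne_top ENNReal.ofReal_ne_top]
      simp
  · obtain ⟨hI0t, hDt⟩ := ENNReal.add_ne_top.1 htop
    obtain ⟨φ, k, hφ, hk, hlaw, hlog⟩ := core_sampler ρ κ c hDt
    set m : ℝ := D.toReal / log 2 + 3 / 2 with hm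
    have hm0 : 0 < m := by
      have : 0 ≤ D.toReal := ENNReal.toReal_nonneg
      positivity
    obtain ⟨q, iq, hq⟩ := exists_q m hm0
    have hbound := core_bound ρ φ k hφ hk q (fun j => (hq j).1)
    have hom := measurable_outMap (𝒳 := 𝒳) hφ hk
    have hgm : Measurable (fun p : (𝒳 × 𝒰) × ZSp => φ (p.1.2, (p.2 (k p)).1)) :=
      measurable_fst.comp (measurable_snd.comp (measurable_snd.comp hom))
    refine ⟨fun p => φ (p.1.2, (p.2 (k p)).1), hgm, hlaw, (ρ.prod πZ).map (outMap φ k), rfl, ?_⟩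
    set M := (ρ.prod πZ).map (outMap φ k) with hM
    have iM : IsProbabilityMeasure M := Measure.isProbabilityMeasure_map hom.aemeasurable
    have iM1 : IsProbabilityMeasure (M.map Prod.fst) :=
      Measure.isProbabilityMeasure_map measurable_fst.aemeasurable
    have iM2 : IsProbabilityMeasure (M.map Prod.snd) :=
      Measure.isProbabilityMeasure_map measurable_snd.aemeasurable
    rw [hfst, hsnd] at hbound
    have hcmi : cmiBits μ X Y U = (I0 + D) / ENNReal.ofReal (log 2)
        - I0 / ENNReal.ofReal (log 2) := by
      unfold cmiBits
      rw [hmiXU, hmiXYU]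
    rw [klBits_eq, hcmi, hmiXYU]
    set W := ∫⁻ p, ENNReal.ofReal (-log (q {k p}).toReal) ∂(ρ.prod πZ) with hW
    have hWle : W ≤ ENNReal.ofReal (1 + 1 / m) * (1 + D) + ENNReal.ofReal (log (1 + m)) := by
      have hlm : Measurable (fun p => ENNReal.ofReal (log ((k p : ℝ) + 1))) :=
        (measurable_log.comp
          (((measurable_of_countable (fun n : ℕ => (n : ℝ))).comp hk).add_const 1)).ennreal_ofReal
      calc W ≤ ∫⁻ p, ENNReal.ofReal (1 + 1 / m) * ENNReal.ofReal (log ((k p : ℝ) + 1))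
              + ENNReal.ofReal (log (1 + m)) ∂(ρ.prod πZ) := by
            refine lintegral_mono fun p => ?_
            rw [← ENNReal.ofReal_mul (by positivity), ← ENNReal.ofReal_add]
            · exact ENNReal.ofReal_le_ofReal (hq (k p)).2
            · have : 0 ≤ log ((k p : ℝ) + 1) :=
                log_nonneg (by have : (0 : ℝ) ≤ k p := Nat.cast_nonneg _; linarith)
              positivity
            · exact log_nonneg (by linarith)
        _ = ENNReal.ofReal (1 + 1 / m) * ∫⁻ p, ENNReal.ofReal (log ((k p : ℝ) + 1)) ∂(ρ.prod πZ)
              + ENNReal.ofReal (log (1 + m)) := by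
            rw [lintegral_add_right _ measurable_const, lintegral_const_mul _ hlm]
            simp
        _ ≤ _ := by gcongr
    refine le_trans ?_ (final_calc I0 D W hI0t hDt m hm hWle)
    gcongr

end Final

/-- **Conditional strong functional representation lemma** (equation (2) of the paper).
For any jointly distributed `(U,X,Y)` over Polish spaces with `I(X;Y|U) < ∞`, there exists
(on an extension preserving the joint law of `(U,X,Y)`) a random variable `Z` independent of
the pair `(X,U)` such that `Y` is a.s. a measurable function of `(X,Z,U)` and
`I(X;Z|Y,U) ≤ log₂(I(X;Y|U)+1) + 4` bits. -/
theorem conditional_strong_functional_representation_lemma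
    {Ω 𝒰 𝒳 𝒴 : Type*} [MeasurableSpace Ω]
    [TopologicalSpace 𝒰] [PolishSpace 𝒰] [MeasurableSpace 𝒰] [BorelSpace 𝒰]
    [TopologicalSpace 𝒳] [PolishSpace 𝒳] [MeasurableSpace 𝒳] [BorelSpace 𝒳]
    [TopologicalSpace 𝒴] [PolishSpace 𝒴] [MeasurableSpace 𝒴] [BorelSpace 𝒴]
    (μ : Measure Ω) [IsProbabilityMeasure μ]
    (U : Ω → 𝒰) (X : Ω → 𝒳) (Y : Ω → 𝒴)
    (hU : Measurable U) (hX : Measurable X) (hY : Measurable Y)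
    (hfin : cmiBits μ X Y U ≠ ⊤) :
    ∃ (Ω' : Type) (_ : MeasurableSpace Ω') (μ' : Measure Ω') (_ : IsProbabilityMeasure μ')
      (𝒵 : Type) (_ : MeasurableSpace 𝒵)
      (U' : Ω' → 𝒰) (X' : Ω' → 𝒳) (Y' : Ω' → 𝒴) (Z : Ω' → 𝒵),
      Measurable U' ∧ Measurable X' ∧ Measurable Y' ∧ Measurable Z ∧
      -- (U',X',Y') has the same joint law as (U,X,Y)
      μ'.map (fun ω => (U' ω, X' ω, Y' ω)) = μ.map (fun ω => (U ω, X ω, Y ω)) ∧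
      -- Z is independent of the pair (X,U)
      IndepFun (fun ω => (X' ω, U' ω)) Z μ' ∧
      -- Y is a.s. a measurable function of (X,Z,U)
      (∃ g : 𝒳 × 𝒵 × 𝒰 → 𝒴, Measurable g ∧ Y' =ᵐ[μ'] fun ω => g (X' ω, Z ω, U' ω)) ∧
      -- I(X;Z|Y,U) ≤ log₂(I(X;Y|U)+1) + 4
      cmiBits μ' X' Z (fun ω => (Y' ω, U' ω)) ≤
        ENNReal.ofReal (Real.logb 2 ((cmiBits μ X Y U).toReal + 1) + 4) := by
  obtain ⟨ω0⟩ : Nonempty Ω := nonempty_of_isProbabilityMeasure μ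
  have n1 : Nonempty 𝒰 := ⟨U ω0⟩
  have n2 : Nonempty 𝒳 := ⟨X ω0⟩
  have n3 : Nonempty 𝒴 := ⟨Y ω0⟩
  obtain ⟨g, hg, hl, M, hM, hB⟩ := main_aux μ U X Y hU hX hY
  exact assemble μ U X Y hU hX hY g hg hl M hM _ hB
end
end

section
/- One-shot exact channel simulation with unlimited common randomness: for any joint distribution P_{XY} (over Polish spaces) with I(X;Y) < ∞, there exist a random variable W independent of X, an encoding function mapping (X,W) to a string M in a prefix-free subset of {0,1}*, and a decoding function mapping (M,W) to Ŷ, such that (X, Ŷ) has joint distribution P_{XY} and the expected description length satisfies E[L(M)] ≤ I(X;Y) + log₂(I(X;Y)+1) + 5 bits. -/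
open MeasureTheory ProbabilityTheory Real
open scoped ENNReal

noncomputable section
/-- Binary strings `{0,1}*` carry the discrete σ-algebra. -/
instance : MeasurableSpace (List Bool) := ⊤

namespace ChanSim

/-! ### Prefix-free codes from monotone Kraft lengths -/

/-- The `l`-bit (most significant bit first) binary expansion of `n`. -/
def bits : ℕ → ℕ → List Bool
  | 0, _ => []
  | l + 1, n => bits l (n / 2) ++ [decide (n % 2 = 1)]

lemma bits_length (l n : ℕ) : (bits l n).length = l := by
  induction l generalizing n with
  | zero => rfl
  | succ l ih => simp [bits, ih]

lemma bits_inj (l a b : ℕ) (ha : a < 2 ^ l) (hb : b < 2 ^ l) (h : bits l a = bits l b) : a = b := by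
  induction l generalizing a b with
  | zero => simp at ha hb; omega
  | succ l ih =>
    simp only [bits] at h
    have h1 := List.append_inj h (by simp [bits_length])
    have h2 := ih (a / 2) (b / 2) (by rw [pow_succ] at ha; omega) (by rw [pow_succ] at hb; omega) h1.1
    have h3 : (a % 2 = 1) ↔ (b % 2 = 1) := by simpa using h1.2
    omega

lemma bits_prefix (l d n : ℕ) : bits l (n / 2 ^ d) <+: bits (l + d) n := by
  induction d generalizing n with
  | zero => simp
  | succ d ih =>
    have h := ih (n / 2)
    rw [Nat.div_div_eq_div_mul, ← pow_succ'] at h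
    exact h.trans (by rw [← add_assoc]; simp [bits])

/-- canonical integer codeword -/
def cw (ℓ : ℕ → ℕ) (k : ℕ) : ℕ := ∑ j ∈ Finset.range k, 2 ^ (ℓ k - ℓ j)

def code (ℓ : ℕ → ℕ) (k : ℕ) : List Bool := bits (ℓ k) (cw ℓ k)

lemma cw_lt {ℓ : ℕ → ℕ} (hm : Monotone ℓ)
    (hk : ∀ n, ∑ j ∈ Finset.range n, (2 : ℝ) ^ (-(ℓ j : ℝ)) ≤ 1) (k : ℕ) : cw ℓ k < 2 ^ ℓ k := by
  have h := hk (k + 1)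
  rw [Finset.sum_range_succ] at h
  have e : ((cw ℓ k : ℕ) : ℝ) = 2 ^ (ℓ k) * ∑ j ∈ Finset.range k, (2 : ℝ) ^ (-(ℓ j : ℝ)) := by
    rw [cw, Finset.mul_sum]
    push_cast
    refine Finset.sum_congr rfl fun j hj => ?_
    have hj' : ℓ j ≤ ℓ k := hm (Finset.mem_range.1 hj).le
    rw [Real.rpow_neg (by norm_num), Real.rpow_natCast, pow_sub₀ _ (by norm_num) hj']
  have h2 : (2 : ℝ) ^ (-(ℓ k : ℝ)) = (2 ^ ℓ k)⁻¹ := by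
    rw [Real.rpow_neg (by norm_num), Real.rpow_natCast]
  have h3 : (0 : ℝ) < 2 ^ ℓ k := by positivity
  have : ((cw ℓ k : ℕ) : ℝ) < 2 ^ ℓ k := by
    rw [e]
    have h4 : ∑ j ∈ Finset.range k, (2 : ℝ) ^ (-(ℓ j : ℝ)) < 1 := by
      rw [h2] at h
      have : (0 : ℝ) < (2 ^ ℓ k)⁻¹ := by positivity
      linarith
    nlinarith
  exact_mod_cast this

lemma cw_step {ℓ : ℕ → ℕ} (hm : Monotone ℓ) {i j : ℕ} (hij : i < j) :
    2 ^ (ℓ j - ℓ i) * (cw ℓ i + 1) ≤ cw ℓ j := by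
  have h1 : ∑ t ∈ Finset.range (i + 1), 2 ^ (ℓ j - ℓ t) ≤ cw ℓ j := by
    apply Finset.sum_le_sum_of_subset
    exact Finset.range_mono hij
  refine le_trans (le_of_eq ?_) h1
  rw [Finset.sum_range_succ, mul_add, mul_one, cw, Finset.mul_sum]
  congr 1
  refine Finset.sum_congr rfl fun t ht => ?_
  have a1 : ℓ t ≤ ℓ i := hm (Finset.mem_range.1 ht).le
  have a2 : ℓ i ≤ ℓ j := hm hij.le
  rw [← pow_add]
  congr 1
  omega

lemma code_length (ℓ : ℕ → ℕ) (k : ℕ) : (code ℓ k).length = ℓ k := bits_length _ _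

lemma code_prefix {ℓ : ℕ → ℕ} (hm : Monotone ℓ)
    (hk : ∀ n, ∑ j ∈ Finset.range n, (2 : ℝ) ^ (-(ℓ j : ℝ)) ≤ 1) {i j : ℕ}
    (h : code ℓ i <+: code ℓ j) : i = j := by
  have key : ∀ i j, i < j → ¬ code ℓ i <+: code ℓ j := by
    intro i j hij h
    have hl : ℓ i ≤ ℓ j := hm hij.le
    have h1 := bits_prefix (ℓ i) (ℓ j - ℓ i) (cw ℓ j)
    rw [Nat.add_sub_cancel' hl] at h1
    have h2 : code ℓ i = bits (ℓ i) (cw ℓ j / 2 ^ (ℓ j - ℓ i)) := by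
      have := List.prefix_of_prefix_length_le h h1 (by simp [code, bits_length])
      exact this.eq_of_length (by simp [code, bits_length])
    have h3 := bits_inj _ _ _ (cw_lt hm hk i) (by
      have := cw_lt hm hk j
      rw [Nat.div_lt_iff_lt_mul (by positivity), ← pow_add, Nat.add_sub_cancel' hl]
      exact this) h2
    have h4 : cw ℓ i + 1 ≤ cw ℓ j / 2 ^ (ℓ j - ℓ i) := by
      rw [Nat.le_div_iff_mul_le (by positivity), mul_comm]
      exact cw_step hm hij
    omega
  rcases lt_trichotomy i j with hij | hij | hij
  · exact absurd h (key i j hij)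
  · exact hij
  · exfalso
    have hl : ℓ j ≤ ℓ i := hm hij.le
    have h1 := h.length_le
    simp only [code_length] at h1
    have h2 : code ℓ i = code ℓ j := h.eq_of_length (by simp only [code_length]; omega)
    exact key j i hij (h2 ▸ List.prefix_rfl)

/-! ### The power-law lengths -/

/-- Codeword lengths adapted to a bound `m` on `E log₂ K`. -/
def len (m : ℝ) (k : ℕ) : ℕ := ⌈(1 + 1 / m) * logb 2 (k + 1) + logb 2 (1 + m)⌉₊

lemma len_arg_nonneg {m : ℝ} (hm : 0 < m) (k : ℕ) :
    0 ≤ (1 + 1 / m) * logb 2 ((k : ℝ) + 1) + logb 2 (1 + m) := by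
  have h1 : 0 ≤ logb 2 ((k : ℝ) + 1) := logb_nonneg (by norm_num) (by linarith [k.cast_nonneg (α := ℝ)])
  have h2 : 0 ≤ logb 2 (1 + m) := logb_nonneg (by norm_num) (by linarith)
  positivity

lemma len_le {m : ℝ} (hm : 0 < m) (k : ℕ) :
    (len m k : ℝ) ≤ (1 + 1 / m) * logb 2 ((k : ℝ) + 1) + logb 2 (1 + m) + 1 :=
  (Nat.ceil_lt_add_one (len_arg_nonneg hm k)).le

lemma len_mono {m : ℝ} (hm : 0 < m) : Monotone (len m) := by
  intro a b hab
  apply Nat.ceil_mono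
  have : (a : ℝ) ≤ b := by exact_mod_cast hab
  have h2 : logb 2 ((a : ℝ) + 1) ≤ logb 2 ((b : ℝ) + 1) :=
    logb_le_logb_of_le (by norm_num) (by positivity) (by linarith)
  gcongr

lemma zeta_bound {m : ℝ} (hm : 0 < m) (n : ℕ) :
    ∑ j ∈ Finset.range n, ((j : ℝ) + 1) ^ (-(1 + 1 / m)) ≤ 1 + m := by
  cases n with
  | zero => simp; linarith
  | succ n =>
    rw [Finset.sum_range_succ']
    have hA : AntitoneOn (fun x : ℝ => x ^ (-(1 + 1 / m))) (Set.Icc 1 (1 + n)) := by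
      intro x hx y hy hxy
      apply Real.rpow_le_rpow_of_nonpos (by linarith [hx.1]) hxy
      have : 0 < 1 / m := by positivity
      linarith
    have h := hA.sum_le_integral
    have hm' : 0 < 1 / m := by positivity
    rw [integral_rpow (Or.inr ⟨by linarith, by
      rw [Set.uIcc_of_le (by linarith [n.cast_nonneg (α := ℝ)])]
      intro h0; linarith [h0.1]⟩)] at h
    have e : -(1 + 1 / m) + 1 = -(1 / m) := by ring
    rw [e, Real.one_rpow] at h
    have hp : (0 : ℝ) < (1 + n : ℝ) ^ (-(1 / m)) := by positivity
    have h3 : ((1 + n : ℝ) ^ (-(1 / m)) - 1) / -(1 / m) ≤ m := by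
      have : ((1 + n : ℝ) ^ (-(1 / m)) - 1) / -(1 / m) = m * (1 - (1 + n : ℝ) ^ (-(1 / m))) := by
        field_simp
        ring
      rw [this]
      nlinarith
    have h4 : ∑ j ∈ Finset.range n, (((j + 1 : ℕ) : ℝ) + 1) ^ (-(1 + 1 / m)) =
        ∑ j ∈ Finset.range n, (1 + ((j + 1 : ℕ) : ℝ)) ^ (-(1 + 1 / m)) := by
      simp only [add_comm]
    rw [h4]
    simp only [Nat.cast_zero, zero_add, Real.one_rpow]
    linarith

lemma len_kraft {m : ℝ} (hm : 0 < m) (n : ℕ) :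
    ∑ j ∈ Finset.range n, (2 : ℝ) ^ (-(len m j : ℝ)) ≤ 1 := by
  have h : ∀ j : ℕ, (2 : ℝ) ^ (-(len m j : ℝ)) ≤ ((j : ℝ) + 1) ^ (-(1 + 1 / m)) * (1 + m)⁻¹ := by
    intro j
    have h1 : (1 + 1 / m) * logb 2 ((j : ℝ) + 1) + logb 2 (1 + m) ≤ len m j := Nat.le_ceil _
    calc (2 : ℝ) ^ (-(len m j : ℝ))
        ≤ 2 ^ (-((1 + 1 / m) * logb 2 ((j : ℝ) + 1) + logb 2 (1 + m))) :=
          Real.rpow_le_rpow_of_exponent_le (by norm_num) (by linarith)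
      _ = _ := by
          rw [neg_add, Real.rpow_add (by norm_num), Real.rpow_neg (x := 2) (y := logb 2 (1 + m)) (by norm_num),
            Real.rpow_logb (by norm_num) (by norm_num) (by linarith), ← neg_mul, mul_comm (-(1 + 1 / m)),
            Real.rpow_mul (by norm_num), Real.rpow_logb (by norm_num) (by norm_num) (by positivity)]
  calc _ ≤ ∑ j ∈ Finset.range n, ((j : ℝ) + 1) ^ (-(1 + 1 / m)) * (1 + m)⁻¹ :=
        Finset.sum_le_sum fun j _ => h j
    _ = (∑ j ∈ Finset.range n, ((j : ℝ) + 1) ^ (-(1 + 1 / m))) * (1 + m)⁻¹ := by rw [Finset.sum_mul]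
    _ ≤ (1 + m) * (1 + m)⁻¹ := by gcongr; exact zeta_bound hm n
    _ = 1 := mul_inv_cancel₀ (by linarith)

/-- Final arithmetic. -/
lemma final_arith {I : ℝ} (hI : 0 ≤ I) :
    (1 + 1 / (I + logb 2 3)) * (I + logb 2 3) + logb 2 (1 + (I + logb 2 3)) + 1 ≤
      I + logb 2 (I + 1) + 5 := by
  have hc0 : 0 < logb 2 3 := logb_pos (by norm_num) (by norm_num)
  have hc : logb 2 3 ≤ 5 / 3 := by
    have : logb 2 ((3 : ℝ) ^ 3) ≤ logb 2 ((2 : ℝ) ^ 5) :=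
      logb_le_logb_of_le (by norm_num) (by norm_num) (by norm_num)
    rw [logb_pow, logb_pow, logb_self_eq_one (by norm_num)] at this
    norm_num at this
    linarith
  have h1 : (1 + 1 / (I + logb 2 3)) * (I + logb 2 3) = I + logb 2 3 + 1 := by
    field_simp
  rw [h1]
  have h2 : logb 2 (1 + (I + logb 2 3)) ≤ logb 2 ((I + 1) * (8 / 3)) :=
    logb_le_logb_of_le (by norm_num) (by positivity) (by nlinarith)
  rw [logb_mul (by positivity) (by norm_num), logb_div (by norm_num) (by norm_num)] at h2
  have h3 : logb 2 (8 : ℝ) = 3 := by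
    rw [show (8 : ℝ) = 2 ^ 3 by norm_num, logb_pow, logb_self_eq_one (by norm_num)]; norm_num
  linarith

end ChanSim

namespace ChanSim

open InformationTheory

section Greedy

variable {𝒴 : Type*} [MeasurableSpace 𝒴]

/-- Residual mass above level `t`. -/
def G (Q : Measure 𝒴) (f : 𝒴 → ℝ) (t : ℝ) : ℝ := ∫ y, max (f y - t) 0 ∂Q

/-- Levels of the greedy rejection sampler. -/
def Lv (Q : Measure 𝒴) (f : 𝒴 → ℝ) : ℕ → ℝ
  | 0 => 0
  | n + 1 => Lv Q f n + G Q f (Lv Q f n)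

/-- Probability of being still alive at step `n`. -/
def pr (Q : Measure 𝒴) (f : 𝒴 → ℝ) (n : ℕ) : ℝ := G Q f (Lv Q f n)

variable {Q : Measure 𝒴} {f : 𝒴 → ℝ}

lemma Lv_succ (n : ℕ) : Lv Q f (n + 1) = Lv Q f n + pr Q f n := rfl

lemma G_nonneg (t : ℝ) : 0 ≤ G Q f t := integral_nonneg fun _ => le_max_right _ _

lemma pr_nonneg (n : ℕ) : 0 ≤ pr Q f n := G_nonneg _

lemma Lv_mono : Monotone (Lv Q f) := monotone_nat_of_le_succ fun n => by
  rw [Lv_succ]; linarith [pr_nonneg (Q := Q) (f := f) n]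

lemma Lv_nonneg (n : ℕ) : 0 ≤ Lv Q f n := Lv_mono (Nat.zero_le n)

variable [IsProbabilityMeasure Q]

lemma int_max (hfi : Integrable f Q) (t : ℝ) : Integrable (fun y => max (f y - t) 0) Q :=
  (hfi.sub (integrable_const t)).pos_part

lemma int_min (hfi : Integrable f Q) (t : ℝ) : Integrable (fun y => min (f y) t) Q :=
  hfi.inf (integrable_const t)

lemma G_anti (hfi : Integrable f Q) : Antitone (G Q f) := by
  intro s t hst
  refine integral_mono (int_max hfi t) (int_max hfi s) fun y => ?_
  exact max_le_max (by linarith) le_rfl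

lemma pr_anti (hfi : Integrable f Q) : Antitone (pr Q f) := (G_anti hfi).comp_monotone Lv_mono

lemma integral_min (hfi : Integrable f Q) (h1 : ∫ y, f y ∂Q = 1) (t : ℝ) :
    ∫ y, min (f y) t ∂Q = 1 - G Q f t := by
  rw [G, ← h1, ← integral_sub hfi (int_max hfi t)]
  congr 1
  ext y
  rcases le_total (f y) t with h | h
  · rw [min_eq_left h, max_eq_right (by linarith)]; ring
  · rw [min_eq_right h, max_eq_left (by linarith)]; ring

lemma pr_zero (hf0 : ∀ y, 0 ≤ f y) (h1 : ∫ y, f y ∂Q = 1) : pr Q f 0 = 1 := by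
  rw [← h1]
  refine integral_congr_ae (Filter.Eventually.of_forall fun y => ?_)
  simp [Lv, hf0 y]

lemma Lv_one (hf0 : ∀ y, 0 ≤ f y) (h1 : ∫ y, f y ∂Q = 1) : Lv Q f 1 = 1 := by
  rw [Lv_succ, pr_zero hf0 h1]; simp [Lv]

lemma mul_pr_le (hfi : Integrable f Q) (n : ℕ) : n * pr Q f n ≤ Lv Q f n := by
  induction n with
  | zero => simp [Lv]
  | succ n ih =>
    rw [Lv_succ]
    have := pr_anti (Q := Q) hfi (Nat.le_succ n)
    push_cast
    nlinarith [pr_nonneg (Q := Q) (f := f) n]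

lemma tendsto_pr (hf0 : ∀ y, 0 ≤ f y) (hfi : Integrable f Q) :
    Filter.Tendsto (pr Q f) Filter.atTop (nhds 0) := by
  rcases tendsto_atTop_of_monotone (Lv_mono (Q := Q) (f := f)) with h | ⟨l, hl⟩
  · have : Filter.Tendsto (fun n => ∫ y, max (f y - Lv Q f n) 0 ∂Q) Filter.atTop
        (nhds (∫ y, (0 : ℝ) ∂Q)) := by
      refine tendsto_integral_of_dominated_convergence f (fun n => (int_max hfi _).1) hfi
        (fun n => Filter.Eventually.of_forall fun y => ?_) (Filter.Eventually.of_forall fun y => ?_)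
      · rw [Real.norm_of_nonneg (le_max_right _ _)]
        exact max_le (by linarith [Lv_nonneg (Q := Q) (f := f) n]) (hf0 y)
      · refine tendsto_const_nhds.congr' ?_
        filter_upwards [h.eventually_ge_atTop (f y)] with n hn
        rw [max_eq_right (by linarith)]
    rw [integral_zero] at this
    exact this
  · have h2 := ((Filter.tendsto_add_atTop_iff_nat 1).2 hl).sub hl
    rw [sub_self] at h2
    refine h2.congr fun n => ?_
    rw [Lv_succ]; ring

/-! #### The expected logarithm of the index -/

lemma klFun_tangent {a b : ℝ} (ha : 0 < a) (hb : 0 ≤ b) :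
    klFun a + log a * (b - a) ≤ klFun b := by
  rcases hb.eq_or_lt with rfl | hb
  · simp only [klFun]; simp; nlinarith
  · have h := Real.log_le_sub_one_of_pos (div_pos ha hb)
    rw [Real.log_div ha.ne' hb.ne'] at h
    simp only [klFun]
    have h2 : b * (log a - log b) ≤ b * (a / b - 1) := mul_le_mul_of_nonneg_left h hb.le
    have h3 : b * (a / b - 1) = a - b := by field_simp
    nlinarith

lemma int_klFun_min (hf0 : ∀ y, 0 ≤ f y) (hfi : Integrable f Q) (t : ℝ) (ht : 0 ≤ t) :
    Integrable (fun y => klFun (min (f y) t)) Q := by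
  obtain ⟨C, hC⟩ := (isCompact_Icc (a := (0 : ℝ)) (b := t)).exists_bound_of_continuousOn
    continuous_klFun.continuousOn
  refine Integrable.of_bound (continuous_klFun.comp_aestronglyMeasurable (int_min hfi t).1) C
    (Filter.Eventually.of_forall fun y => ?_)
  exact hC _ ⟨le_min (hf0 y) ht, min_le_right _ _⟩

/-- `p - p log p`, extended by zero. -/
def phi (u : ℝ) : ℝ := u - u * log u

lemma phi_step {a b : ℝ} (ha : 0 < a) (hb : 0 ≤ b) : (a - b) * (-log a) ≤ phi a - phi b := by
  have := klFun_tangent ha hb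
  simp only [klFun, phi] at *
  nlinarith

lemma phi_nonneg {a : ℝ} (ha : 0 ≤ a) (ha1 : a ≤ 1) : 0 ≤ phi a := by
  have := Real.log_nonpos ha ha1
  unfold phi; nlinarith

lemma term_bound (hf0 : ∀ y, 0 ≤ f y) (hfi : Integrable f Q) (h1 : ∫ y, f y ∂Q = 1) (k : ℕ)
    (hk : 1 ≤ k) :
    (pr Q f k - pr Q f (k + 1)) * log ((k : ℝ) + 1) ≤
      (pr Q f k - pr Q f (k + 1)) * log (1 + pr Q f 1) +
      (∫ y, klFun (min (f y) (Lv Q f (k + 1))) ∂Q - ∫ y, klFun (min (f y) (Lv Q f k)) ∂Q) +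
      (phi (pr Q f k) - phi (pr Q f (k + 1))) := by
  have hL1 : 1 ≤ Lv Q f k := by rw [← Lv_one hf0 h1]; exact Lv_mono hk
  have hm0 : 0 ≤ pr Q f k - pr Q f (k + 1) := by
    linarith [pr_anti (Q := Q) hfi (Nat.le_succ k)]
  have hm : pr Q f k - pr Q f (k + 1) =
      ∫ y, (min (f y) (Lv Q f (k + 1)) - min (f y) (Lv Q f k)) ∂Q := by
    rw [integral_sub (int_min hfi _) (int_min hfi _), integral_min hfi h1, integral_min hfi h1]
    simp only [pr]; ring
  have hLk : Lv Q f k ≤ Lv Q f (k + 1) := Lv_mono (Nat.le_succ k)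
  have hB : (pr Q f k - pr Q f (k + 1)) * log (Lv Q f k) ≤
      ∫ y, klFun (min (f y) (Lv Q f (k + 1))) ∂Q - ∫ y, klFun (min (f y) (Lv Q f k)) ∂Q := by
    rw [← integral_sub (int_klFun_min hf0 hfi _ (Lv_nonneg _))
      (int_klFun_min hf0 hfi _ (Lv_nonneg _)), hm, ← integral_mul_const]
    refine integral_mono (((int_min hfi _).sub (int_min hfi _)).mul_const _)
      ((int_klFun_min hf0 hfi _ (Lv_nonneg _)).sub (int_klFun_min hf0 hfi _ (Lv_nonneg _)))
      fun y => ?_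
    simp only
    rcases le_total (f y) (Lv Q f k) with h | h
    · rw [min_eq_left h, min_eq_left (h.trans hLk)]; simp
    · rw [min_eq_right h]
      have := klFun_tangent (a := Lv Q f k) (b := min (f y) (Lv Q f (k + 1))) (by linarith)
        (le_min (hf0 y) (Lv_nonneg _))
      linarith
  rcases (pr_nonneg (Q := Q) (f := f) k).eq_or_lt with h0 | hpos
  · have h0' : pr Q f (k + 1) = 0 :=
      le_antisymm (by linarith) (pr_nonneg _)
    rw [h0', ← h0] at hB ⊢
    simp at hB ⊢
    linarith
  · have hC := phi_step hpos (pr_nonneg (Q := Q) (f := f) (k + 1))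
    have hlog : log ((k : ℝ) + 1) ≤ log (1 + pr Q f 1) + log (Lv Q f k) + -log (pr Q f k) := by
      rw [← Real.log_mul (by linarith [pr_nonneg (Q := Q) (f := f) 1]) (by linarith), ← sub_eq_add_neg,
        ← Real.log_div _ hpos.ne']
      · apply Real.log_le_log (by positivity)
        rw [le_div_iff₀ hpos]
        have a1 := mul_pr_le (Q := Q) hfi k
        have a2 : pr Q f k ≤ pr Q f 1 := pr_anti hfi hk
        have a3 := pr_nonneg (Q := Q) (f := f) 1
        nlinarith
      · have a3 := pr_nonneg (Q := Q) (f := f) 1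
        positivity
    have := mul_le_mul_of_nonneg_left hlog hm0
    nlinarith

lemma entropy_bound {g : ℝ} (hg0 : 0 ≤ g) (hg1 : g < 1) :
    g * log (1 + g) + phi g - klFun (1 - g) ≤ log 3 := by
  have hc := strictConcaveOn_log_Ioi.concaveOn
  have e : g * log (1 + g) + phi g - klFun (1 - g) =
      g * (log (1 + g) - log g) + (1 - g) * (- log (1 - g)) := by
    simp only [phi, klFun]; ring
  rw [e]
  rcases hg0.eq_or_lt with rfl | hg
  · simp; exact Real.log_nonneg (by norm_num)
  · rw [← Real.log_div (by positivity) hg.ne', ← Real.log_inv]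
    have := hc.2 (x := (1 + g) / g) (y := (1 - g)⁻¹) (Set.mem_Ioi.2 (by positivity))
      (Set.mem_Ioi.2 (inv_pos.2 (by linarith))) hg0 (by linarith : 0 ≤ 1 - g) (by ring)
    simp only [smul_eq_mul] at this
    refine this.trans ?_
    have h2 : g * ((1 + g) / g) + (1 - g) * (1 - g)⁻¹ = 2 + g := by
      rw [mul_inv_cancel₀ (by linarith)]; field_simp; ring
    rw [h2]
    exact Real.log_le_log (by linarith) (by linarith)

lemma sum_bound (hf0 : ∀ y, 0 ≤ f y) (hfi : Integrable f Q) (h1 : ∫ y, f y ∂Q = 1)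
    (hkl : Integrable (fun y => klFun (f y)) Q) (n : ℕ) :
    ∑ k ∈ Finset.range n, (pr Q f k - pr Q f (k + 1)) * log ((k : ℝ) + 1) ≤
      ∫ y, klFun (f y) ∂Q + log 3 := by
  have hp1 : pr Q f 1 ≤ 1 := by rw [← pr_zero hf0 h1]; exact pr_anti hfi (Nat.zero_le 1)
  have hg1 : pr Q f 1 < 1 := by
    refine lt_of_le_of_ne hp1 fun h => ?_
    have h2 : ∫ y, min (f y) 1 ∂Q = 0 := by
      have hG : G Q f 1 = pr Q f 1 := by rw [pr, Lv_one hf0 h1]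
      rw [integral_min hfi h1, hG, h, sub_self]
    rw [integral_eq_zero_iff_of_nonneg (fun y => le_min (hf0 y) zero_le_one) (int_min hfi 1)] at h2
    have h3 : ∫ y, f y ∂Q = ∫ y, (0 : ℝ) ∂Q := by
      refine integral_congr_ae ?_
      filter_upwards [h2] with y hy
      simp only [Pi.zero_apply] at hy
      rcases min_choice (f y) 1 with h | h <;> rw [h] at hy
      · exact hy
      · norm_num at hy
    rw [h1] at h3
    simp at h3
  have hstep : ∀ n : ℕ, ∑ k ∈ Finset.range (n + 1), (pr Q f k - pr Q f (k + 1)) * log ((k : ℝ) + 1) ≤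
      (pr Q f 1 - pr Q f (n + 1)) * log (1 + pr Q f 1) +
      (∫ y, klFun (min (f y) (Lv Q f (n + 1))) ∂Q - ∫ y, klFun (min (f y) 1) ∂Q) +
      (phi (pr Q f 1) - phi (pr Q f (n + 1))) := by
    intro n
    induction n with
    | zero => simp [Lv_one hf0 h1]
    | succ n ih =>
      rw [Finset.sum_range_succ]
      have := term_bound hf0 hfi h1 (n + 1) (by omega)
      nlinarith
  have hJ : klFun (1 - pr Q f 1) ≤ ∫ y, klFun (min (f y) 1) ∂Q := by
    have hmean : ∫ y, min (f y) 1 ∂Q = 1 - pr Q f 1 := by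
      rw [integral_min hfi h1, pr, Lv_one hf0 h1]
    have ha : 0 < 1 - pr Q f 1 := by linarith
    have : ∫ y, (klFun (1 - pr Q f 1) + log (1 - pr Q f 1) * (min (f y) 1 - (1 - pr Q f 1))) ∂Q ≤
        ∫ y, klFun (min (f y) 1) ∂Q := by
      refine integral_mono ?_ (int_klFun_min hf0 hfi _ zero_le_one) fun y =>
        klFun_tangent ha (le_min (hf0 y) zero_le_one)
      exact (integrable_const _).add (((int_min hfi 1).sub (integrable_const _)).const_mul _)
    have hi : Integrable (fun y => log (1 - pr Q f 1) * (min (f y) 1 - (1 - pr Q f 1))) Q :=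
      ((int_min hfi 1).sub (integrable_const _)).const_mul _
    rw [integral_add (integrable_const _) hi,
      integral_const_mul, integral_sub (int_min hfi 1) (integrable_const _), hmean] at this
    simpa using this
  cases n with
  | zero =>
    simp only [Finset.range_zero, Finset.sum_empty]
    have : 0 ≤ ∫ y, klFun (f y) ∂Q := integral_nonneg fun y => klFun_nonneg (hf0 y)
    have := Real.log_nonneg (show (1 : ℝ) ≤ 3 by norm_num)
    linarith
  | succ n =>
    have hK : ∫ y, klFun (min (f y) (Lv Q f (n + 1))) ∂Q ≤ ∫ y, klFun (f y) ∂Q := by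
      have hL1 : 1 ≤ Lv Q f (n + 1) := by rw [← Lv_one hf0 h1]; exact Lv_mono (by omega)
      refine integral_mono (int_klFun_min hf0 hfi _ (Lv_nonneg _)) hkl fun y => ?_
      simp only
      rcases le_total (f y) (Lv Q f (n + 1)) with h | h
      · rw [min_eq_left h]
      · rw [min_eq_right h]
        have a := klFun_tangent (a := Lv Q f (n + 1)) (b := f y) (by linarith) (hf0 y)
        have b := Real.log_nonneg hL1
        nlinarith
    have hE := entropy_bound (pr_nonneg (Q := Q) (f := f) 1) hg1
    have h2 := hstep n
    have h3 : phi (pr Q f (n + 1)) ≥ 0 := phi_nonneg (pr_nonneg _)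
      ((pr_anti hfi (by omega : 1 ≤ n + 1)).trans hp1)
    have h4 : 0 ≤ pr Q f (n + 1) * log (1 + pr Q f 1) :=
      mul_nonneg (pr_nonneg _) (Real.log_nonneg (by linarith [pr_nonneg (Q := Q) (f := f) 1]))
    nlinarith

end Greedy

end ChanSim

namespace ChanSim

open InformationTheory

section Sampler

variable {𝒴 : Type*} [MeasurableSpace 𝒴]

/-- Uniform distribution on `[0,1)`. -/
def U : Measure ℝ := volume.restrict (Set.Ico 0 1)

instance : IsProbabilityMeasure U := ⟨by simp [U]⟩

/-- The acceptance region at step `k`. -/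
def acc (Q : Measure 𝒴) (f : 𝒴 → ℝ) (k : ℕ) : Set (𝒴 × ℝ) :=
  {z | Lv Q f k + z.2 * pr Q f k < f z.1}

/-- Law of the common randomness: i.i.d. pairs of proposals and uniforms. -/
def PW (Q : Measure 𝒴) [IsProbabilityMeasure Q] : Measure (ℕ → 𝒴 × ℝ) :=
  Measure.infinitePi (fun _ : ℕ => Q.prod U)

instance (Q : Measure 𝒴) [IsProbabilityMeasure Q] : IsProbabilityMeasure (PW Q) := by
  unfold PW; infer_instance

/-- Acceptance occurs exactly at step `k`, with value in `A`. -/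
def ev (Q : Measure 𝒴) (f : 𝒴 → ℝ) (k : ℕ) (A : Set 𝒴) : Set (ℕ → 𝒴 × ℝ) :=
  {w | (∀ j < k, w j ∉ acc Q f j) ∧ w k ∈ acc Q f k ∧ (w k).1 ∈ A}

/-- The accepted index. -/
def Kx (Q : Measure 𝒴) (f : 𝒴 → ℝ) (w : ℕ → 𝒴 × ℝ) : ℕ := sInf {k | w k ∈ acc Q f k}

variable {Q : Measure 𝒴} {f : 𝒴 → ℝ}

lemma measurableSet_acc (hf : Measurable f) (k : ℕ) : MeasurableSet (acc Q f k) :=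
  measurableSet_lt (by fun_prop) (by fun_prop)

lemma measurableSet_ev (hf : Measurable f) (k : ℕ) {A : Set 𝒴} (hA : MeasurableSet A) :
    MeasurableSet (ev Q f k A) := by
  have h : ev Q f k A = (⋂ j ∈ Set.Iio k, (fun w : ℕ → 𝒴 × ℝ => w j) ⁻¹' (acc Q f j)ᶜ) ∩
      ((fun w : ℕ → 𝒴 × ℝ => w k) ⁻¹' (acc Q f k ∩ Prod.fst ⁻¹' A)) := by
    ext w; simp [ev]
  rw [h]
  refine MeasurableSet.inter ?_ ?_
  · refine MeasurableSet.biInter (Set.to_countable _) fun j _ => ?_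
    exact measurable_pi_apply j (measurableSet_acc hf j).compl
  · exact measurable_pi_apply k ((measurableSet_acc hf k).inter (measurable_fst hA))

lemma Kx_eq {k : ℕ} {A : Set 𝒴} {w : ℕ → 𝒴 × ℝ} (h : w ∈ ev Q f k A) : Kx Q f w = k := by
  apply le_antisymm
  · exact Nat.sInf_le h.2.1
  · by_contra hlt
    push Not at hlt
    exact h.1 _ hlt (Nat.sInf_mem (s := {k | w k ∈ acc Q f k}) ⟨k, h.2.1⟩)

lemma ev_disjoint (A : Set 𝒴) : Pairwise (Function.onFun Disjoint fun k => ev Q f k A) := by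
  intro i j hij
  rw [Function.onFun, Set.disjoint_left]
  intro w hi hj
  exact hij ((Kx_eq hi).symm.trans (Kx_eq hj))

lemma U_lt (s : ℝ) : U {u | u < s} = ENNReal.ofReal (min s 1) := by
  have hs : MeasurableSet {u : ℝ | u < s} := measurableSet_Iio
  rw [U, Measure.restrict_apply hs]
  have : {u : ℝ | u < s} ∩ Set.Ico 0 1 = Set.Ico 0 (min s 1) := by
    ext u; simp only [Set.mem_inter_iff, Set.mem_ofPred_eq, Set.mem_Ico, lt_min_iff]; tauto
  rw [this, Real.volume_Ico, sub_zero]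

variable [IsProbabilityMeasure Q]

lemma acc_measure (hf : Measurable f) (k : ℕ) {A : Set 𝒴} (hA : MeasurableSet A) :
    ENNReal.ofReal (pr Q f k) * (Q.prod U) (acc Q f k ∩ Prod.fst ⁻¹' A) =
      ∫⁻ y in A, ENNReal.ofReal (min (f y) (Lv Q f (k + 1)) - min (f y) (Lv Q f k)) ∂Q := by
  rcases (pr_nonneg (Q := Q) (f := f) k).eq_or_lt with h0 | hpos
  · rw [Lv_succ, ← h0]; simp
  · rw [Measure.prod_apply ((measurableSet_acc hf k).inter (measurable_fst hA)),
      ← lintegral_const_mul' _ _ ENNReal.ofReal_ne_top, ← lintegral_indicator hA]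
    refine lintegral_congr fun y => ?_
    by_cases hy : y ∈ A
    · rw [Set.indicator_of_mem hy]
      have e : Prod.mk y ⁻¹' (acc Q f k ∩ Prod.fst ⁻¹' A) =
          {u | u < (f y - Lv Q f k) / pr Q f k} := by
        ext u
        simp only [acc, Set.mem_preimage, Set.mem_inter_iff, Set.mem_ofPred_eq, hy, and_true,
          lt_div_iff₀ hpos]
        constructor <;> intro h <;> linarith
      rw [e, U_lt, ← ENNReal.ofReal_mul hpos.le, mul_min_of_nonneg _ _ hpos.le,
        mul_div_cancel₀ _ hpos.ne', mul_one, Lv_succ]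
      rcases le_total (f y) (Lv Q f k) with h | h
      · rw [min_eq_left h, min_eq_left (by linarith : f y ≤ Lv Q f k + pr Q f k), sub_self,
          ENNReal.ofReal_zero, ENNReal.ofReal_eq_zero]
        exact (min_le_left _ _).trans (by linarith)
      · rw [min_eq_right h, ← min_sub_sub_right, add_sub_cancel_left]
    · rw [Set.indicator_of_notMem hy]
      have e : Prod.mk y ⁻¹' (acc Q f k ∩ Prod.fst ⁻¹' A) = ∅ := by
        ext u; simp [hy]
      rw [e]; simp

lemma lint_step (hfi : Integrable f Q) (h1 : ∫ y, f y ∂Q = 1) (k : ℕ) :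
    ∫⁻ y, ENNReal.ofReal (min (f y) (Lv Q f (k + 1)) - min (f y) (Lv Q f k)) ∂Q =
      ENNReal.ofReal (pr Q f k - pr Q f (k + 1)) := by
  rw [← ofReal_integral_eq_lintegral_ofReal]
  · rw [integral_sub (int_min hfi _) (int_min hfi _), integral_min hfi h1, integral_min hfi h1]
    congr 1
    simp only [pr]; ring
  · exact (int_min hfi _).sub (int_min hfi _)
  · refine Filter.Eventually.of_forall fun y => ?_
    simp only [Pi.zero_apply, sub_nonneg]
    exact min_le_min le_rfl (Lv_mono (Nat.le_succ k))

lemma acc_compl (hf : Measurable f) (hfi : Integrable f Q) (h1 : ∫ y, f y ∂Q = 1) (k : ℕ) :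
    ENNReal.ofReal (pr Q f k) * (Q.prod U) (acc Q f k)ᶜ = ENNReal.ofReal (pr Q f (k + 1)) := by
  have h := acc_measure (Q := Q) hf k MeasurableSet.univ
  rw [Set.preimage_univ, Set.inter_univ, Measure.restrict_univ, lint_step hfi h1] at h
  rw [prob_compl_eq_one_sub (measurableSet_acc hf k), ENNReal.mul_sub (by simp), h, mul_one,
    ← ENNReal.ofReal_sub _ (by linarith [pr_anti (Q := Q) hfi (Nat.le_succ k)])]
  congr 1; ring

lemma alive (hf : Measurable f) (hf0 : ∀ y, 0 ≤ f y) (hfi : Integrable f Q)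
    (h1 : ∫ y, f y ∂Q = 1) (k : ℕ) :
    ∏ j ∈ Finset.range k, (Q.prod U) (acc Q f j)ᶜ = ENNReal.ofReal (pr Q f k) := by
  induction k with
  | zero => simp [pr_zero hf0 h1]
  | succ k ih => rw [Finset.prod_range_succ, ih, acc_compl hf hfi h1]

lemma ev_measure (hf : Measurable f) (hf0 : ∀ y, 0 ≤ f y) (hfi : Integrable f Q)
    (h1 : ∫ y, f y ∂Q = 1) (k : ℕ) {A : Set 𝒴} (hA : MeasurableSet A) :
    PW Q (ev Q f k A) =
      ∫⁻ y in A, ENNReal.ofReal (min (f y) (Lv Q f (k + 1)) - min (f y) (Lv Q f k)) ∂Q := by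
  classical
  have e : ev Q f k A = Set.pi (Finset.range (k + 1) : Finset ℕ)
      (fun j => if j < k then (acc Q f j)ᶜ else acc Q f k ∩ Prod.fst ⁻¹' A) := by
    ext w
    simp only [ev, Set.mem_ofPred_eq, Set.mem_pi, Finset.coe_range, Set.mem_Iio]
    constructor
    · rintro ⟨a, b, c⟩ j hj
      split_ifs with hjk
      · exact a j hjk
      · obtain rfl : j = k := by omega
        exact ⟨b, c⟩
    · intro h
      refine ⟨fun j hj => ?_, ?_⟩
      · simpa [hj] using h j (by omega)
      · simpa using h k (by omega)
  rw [e, PW, Measure.infinitePi_pi, Finset.prod_range_succ, ← acc_measure hf k hA,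
    ← alive hf hf0 hfi h1 k]
  · congr 1
    · refine Finset.prod_congr rfl fun j hj => ?_
      rw [if_pos (Finset.mem_range.1 hj)]
    · simp
  · intro j _
    split_ifs
    · exact (measurableSet_acc hf j).compl
    · exact (measurableSet_acc hf k).inter (measurable_fst hA)

lemma partial_le (hf0 : ∀ y, 0 ≤ f y) (y : 𝒴) :
    ∑' k, ENNReal.ofReal (min (f y) (Lv Q f (k + 1)) - min (f y) (Lv Q f k)) ≤
      ENNReal.ofReal (f y) := by
  refine ENNReal.tsum_le_of_sum_range_le fun n => ?_
  rw [← ENNReal.ofReal_sum_of_nonneg]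
  · apply ENNReal.ofReal_le_ofReal
    rw [Finset.sum_range_sub (fun k => min (f y) (Lv Q f k))]
    have : min (f y) (Lv Q f 0) = 0 := by simp [Lv, hf0 y]
    rw [this, sub_zero]
    exact min_le_left _ _
  · intro k _
    exact sub_nonneg.2 (min_le_min le_rfl (Lv_mono (Nat.le_succ k)))

lemma tsum_pr (hf0 : ∀ y, 0 ≤ f y) (hfi : Integrable f Q) (h1 : ∫ y, f y ∂Q = 1) :
    ∑' k, ENNReal.ofReal (pr Q f k - pr Q f (k + 1)) = 1 := by
  have hnn : ∀ k, 0 ≤ pr Q f k - pr Q f (k + 1) := fun k =>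
    sub_nonneg.2 (pr_anti hfi (Nat.le_succ k))
  have h : HasSum (fun k => pr Q f k - pr Q f (k + 1)) 1 := by
    rw [hasSum_iff_tendsto_nat_of_nonneg hnn]
    have := (tendsto_pr hf0 hfi).const_sub (pr Q f 0)
    rw [sub_zero, pr_zero hf0 h1] at this
    refine this.congr fun n => ?_
    rw [Finset.sum_range_sub' (fun k => pr Q f k), pr_zero hf0 h1]
  rw [← ENNReal.ofReal_tsum_of_nonneg hnn h.summable, h.tsum_eq, ENNReal.ofReal_one]

lemma ae_tsum (hf : Measurable f) (hf0 : ∀ y, 0 ≤ f y) (hfi : Integrable f Q)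
    (h1 : ∫ y, f y ∂Q = 1) :
    (fun y => ∑' k, ENNReal.ofReal (min (f y) (Lv Q f (k + 1)) - min (f y) (Lv Q f k))) =ᵐ[Q]
      fun y => ENNReal.ofReal (f y) := by
  have hF : ∫⁻ y, ENNReal.ofReal (f y) ∂Q = 1 := by
    rw [← ofReal_integral_eq_lintegral_ofReal hfi (Filter.Eventually.of_forall hf0), h1,
      ENNReal.ofReal_one]
  have hS : ∫⁻ y, ∑' k, ENNReal.ofReal (min (f y) (Lv Q f (k + 1)) - min (f y) (Lv Q f k)) ∂Q = 1 := by
    rw [lintegral_tsum fun k => by fun_prop]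
    simp_rw [lint_step hfi h1]
    exact tsum_pr hf0 hfi h1
  refine ae_eq_of_ae_le_of_lintegral_le (Filter.Eventually.of_forall (partial_le hf0)) ?_
    (by fun_prop) ?_
  · rw [hS]; simp
  · rw [hS, hF]

lemma tsum_ev (hf : Measurable f) (hf0 : ∀ y, 0 ≤ f y) (hfi : Integrable f Q)
    (h1 : ∫ y, f y ∂Q = 1) {A : Set 𝒴} (hA : MeasurableSet A) :
    PW Q (⋃ k, ev Q f k A) = ∫⁻ y in A, ENNReal.ofReal (f y) ∂Q := by
  rw [measure_iUnion (ev_disjoint A) fun k => measurableSet_ev hf k hA]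
  simp_rw [ev_measure hf hf0 hfi h1 _ hA]
  rw [← lintegral_tsum fun k => by fun_prop]
  exact lintegral_congr_ae (ae_restrict_of_ae (ae_tsum hf hf0 hfi h1))

lemma ae_ev (hf : Measurable f) (hf0 : ∀ y, 0 ≤ f y) (hfi : Integrable f Q)
    (h1 : ∫ y, f y ∂Q = 1) : ∀ᵐ w ∂(PW Q), w ∈ ⋃ k, ev Q f k Set.univ := by
  refine (mem_ae_iff_prob_eq_one ?_).2 ?_
  rotate_left
  · change PW Q (⋃ k, ev Q f k Set.univ) = 1
    rw [tsum_ev hf hf0 hfi h1 MeasurableSet.univ, Measure.restrict_univ,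
      ← ofReal_integral_eq_lintegral_ofReal hfi (Filter.Eventually.of_forall hf0), h1,
      ENNReal.ofReal_one]
  · exact MeasurableSet.iUnion fun k => measurableSet_ev hf k MeasurableSet.univ

/-- The accepted sample has density `f`. -/
lemma law (hf : Measurable f) (hf0 : ∀ y, 0 ≤ f y) (hfi : Integrable f Q)
    (h1 : ∫ y, f y ∂Q = 1) {A : Set 𝒴} (hA : MeasurableSet A) :
    PW Q {w | (w (Kx Q f w)).1 ∈ A} = ∫⁻ y in A, ENNReal.ofReal (f y) ∂Q := by
  rw [← tsum_ev hf hf0 hfi h1 hA]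
  apply measure_congr
  filter_upwards [ae_ev hf hf0 hfi h1] with w hw
  obtain ⟨k, hk⟩ := Set.mem_iUnion.1 hw
  apply propext
  change (w (Kx Q f w)).1 ∈ A ↔ w ∈ ⋃ k, ev Q f k A
  rw [Kx_eq hk, Set.mem_iUnion]
  constructor
  · intro h
    exact ⟨k, hk.1, hk.2.1, h⟩
  · rintro ⟨j, hj⟩
    have : k = j := (Kx_eq hk).symm.trans (Kx_eq hj)
    subst this
    exact hj.2.2

/-- Expected logarithm of the index. -/
lemma exp_log (hf : Measurable f) (hf0 : ∀ y, 0 ≤ f y) (hfi : Integrable f Q)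
    (h1 : ∫ y, f y ∂Q = 1) (hkl : Integrable (fun y => klFun (f y)) Q) :
    ∫⁻ w, ENNReal.ofReal (log ((Kx Q f w : ℝ) + 1)) ∂(PW Q) ≤
      ENNReal.ofReal (∫ y, klFun (f y) ∂Q + log 3) := by
  have hm : ∀ k, MeasurableSet (ev Q f k Set.univ) := fun k => measurableSet_ev hf k MeasurableSet.univ
  rw [← setLIntegral_univ, ← setLIntegral_congr (ae_eq_univ.2 (ae_ev hf hf0 hfi h1) : (⋃ k, ev Q f k Set.univ : Set _) =ᵐ[PW Q] Set.univ),
    lintegral_iUnion hm (ev_disjoint Set.univ)]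
  have e : ∀ k, ∫⁻ w in ev Q f k Set.univ, ENNReal.ofReal (log ((Kx Q f w : ℝ) + 1)) ∂(PW Q) =
      ENNReal.ofReal ((pr Q f k - pr Q f (k + 1)) * log ((k : ℝ) + 1)) := by
    intro k
    rw [setLIntegral_congr_fun (g := fun _ => ENNReal.ofReal (log ((k : ℝ) + 1))) (hm k)
      (fun w hw => by simp only [Kx_eq hw]), setLIntegral_const,
      ev_measure hf hf0 hfi h1 k MeasurableSet.univ, Measure.restrict_univ, lint_step hfi h1,
      ENNReal.ofReal_mul (sub_nonneg.2 (pr_anti hfi (Nat.le_succ k))), mul_comm]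
  simp_rw [e]
  refine ENNReal.tsum_le_of_sum_range_le fun n => ?_
  rw [← ENNReal.ofReal_sum_of_nonneg]
  · exact ENNReal.ofReal_le_ofReal (sum_bound hf0 hfi h1 hkl n)
  · intro k _
    exact mul_nonneg (sub_nonneg.2 (pr_anti hfi (Nat.le_succ k)))
      (Real.log_nonneg (by linarith [k.cast_nonneg (α := ℝ)]))

end Sampler

section Joint

variable {𝒳 𝒴 : Type*} [MeasurableSpace 𝒳] [MeasurableSpace 𝒴]
  {Q : Measure 𝒴} [IsProbabilityMeasure Q] {f : 𝒳 → 𝒴 → ℝ}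

lemma measurable_Lv (hf : Measurable (Function.uncurry f)) (n : ℕ) :
    Measurable fun x => Lv Q (f x) n := by
  induction n with
  | zero => exact measurable_const
  | succ n ih =>
    refine ih.add ?_
    have : StronglyMeasurable (Function.uncurry fun x y => max (f x y - Lv Q (f x) n) 0) := by
      apply Measurable.stronglyMeasurable
      exact (hf.sub (ih.comp measurable_fst)).max measurable_const
    exact this.integral_prod_right.measurable

lemma measurable_pr (hf : Measurable (Function.uncurry f)) (n : ℕ) :
    Measurable fun x => pr Q (f x) n := by
  have : (fun x => pr Q (f x) n) = fun x => Lv Q (f x) (n + 1) - Lv Q (f x) n := by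
    ext x; rw [Lv_succ]; ring
  rw [this]
  exact (measurable_Lv hf _).sub (measurable_Lv hf _)

lemma measurable_Kx (hf : Measurable (Function.uncurry f)) :
    Measurable fun p : 𝒳 × (ℕ → 𝒴 × ℝ) => Kx Q (f p.1) p.2 := by
  have hacc : ∀ k, MeasurableSet {p : 𝒳 × (ℕ → 𝒴 × ℝ) | p.2 k ∈ acc Q (f p.1) k} := by
    intro k
    have hL : Measurable fun p : 𝒳 × (ℕ → 𝒴 × ℝ) => Lv Q (f p.1) k :=
      (measurable_Lv (Q := Q) hf k).comp measurable_fst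
    have hp : Measurable fun p : 𝒳 × (ℕ → 𝒴 × ℝ) => pr Q (f p.1) k :=
      (measurable_pr (Q := Q) hf k).comp measurable_fst
    have h1 : Measurable fun p : 𝒳 × (ℕ → 𝒴 × ℝ) => f p.1 (p.2 k).1 :=
      hf.comp (f := fun p : 𝒳 × (ℕ → 𝒴 × ℝ) => (p.1, (p.2 k).1)) (by fun_prop)
    exact measurableSet_lt (by fun_prop) h1
  refine measurable_to_countable' fun k => ?_
  have e : (fun p : 𝒳 × (ℕ → 𝒴 × ℝ) => Kx Q (f p.1) p.2) ⁻¹' {k} =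
      ({p | p.2 k ∈ acc Q (f p.1) k} ∩ ⋂ j ∈ Set.Iio k, {p | p.2 j ∈ acc Q (f p.1) j}ᶜ) ∪
      ({p | k = 0} ∩ ⋂ j, {p | p.2 j ∈ acc Q (f p.1) j}ᶜ) := by
    ext p
    simp only [Set.mem_preimage, Set.mem_singleton_iff, Set.mem_union, Set.mem_inter_iff,
      Set.mem_ofPred_eq, Set.mem_iInter, Set.mem_compl_iff, Set.mem_Iio]
    constructor
    · intro h
      by_cases hne : ∃ j, p.2 j ∈ acc Q (f p.1) j
      · left
        subst h
        refine ⟨Nat.sInf_mem (s := {k | p.2 k ∈ acc Q (f p.1) k}) hne, fun j hj => ?_⟩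
        exact Nat.notMem_of_lt_sInf (s := {k | p.2 k ∈ acc Q (f p.1) k}) hj
      · right
        push Not at hne
        refine ⟨?_, hne⟩
        rw [← h, Kx, Nat.sInf_eq_zero]
        right
        ext j; simpa using hne j
    · rintro (⟨a, b⟩ | ⟨rfl, b⟩)
      · exact Kx_eq (A := Set.univ) ⟨b, a, trivial⟩
      · rw [Kx, Nat.sInf_eq_zero]
        right
        ext j; simpa using b j
  rw [e]
  refine ((hacc k).inter (MeasurableSet.biInter (Set.to_countable _) fun j _ => (hacc j).compl)).union
    (MeasurableSet.inter (MeasurableSet.const _) (MeasurableSet.iInter fun j => (hacc j).compl))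

end Joint

end ChanSim

namespace ChanSim

open InformationTheory

section Assembly

variable {𝒳 𝒴 : Type*} [MeasurableSpace 𝒳] [MeasurableSpace 𝒴]

lemma density (PXY : Measure (𝒳 × 𝒴)) [IsProbabilityMeasure PXY] (hfin : miOfJoint PXY ≠ ⊤) :
    ∃ f : 𝒳 → 𝒴 → ℝ, Measurable (Function.uncurry f) ∧ (∀ x y, 0 ≤ f x y) ∧
      PXY = (PXY.fst.prod PXY.snd).withDensity (fun p => ENNReal.ofReal (f p.1 p.2)) ∧
      (∀ᵐ x ∂PXY.fst, Integrable (f x) PXY.snd ∧ ∫ y, f x y ∂PXY.snd = 1 ∧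
        Integrable (fun y => klFun (f x y)) PXY.snd) ∧
      Integrable (fun x => ∫ y, klFun (f x y) ∂PXY.snd) PXY.fst ∧
      ∫ x, ∫ y, klFun (f x y) ∂PXY.snd ∂PXY.fst ≤ (miOfJoint PXY).toReal * log 2 := by
  have hmi : miOfJoint PXY = klBits PXY (PXY.fst.prod PXY.snd) := by
    simp only [miOfJoint, miBits]
    congr 1
    exact Measure.map_id
  rw [hmi] at hfin ⊢
  set R := PXY.fst.prod PXY.snd with hR
  have hc : PXY ≪ R ∧ Integrable (fun x => Real.logb 2 (PXY.rnDeriv R x).toReal) PXY := by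
    by_contra hc
    exact hfin (by rw [klBits, if_neg hc])
  have hlog2 : 0 < log 2 := Real.log_pos (by norm_num)
  have hllr : ∀ p, llr PXY R p = logb 2 (PXY.rnDeriv R p).toReal * log 2 := by
    intro p
    rw [llr, logb, div_mul_cancel₀ _ hlog2.ne']
  have hllri : Integrable (llr PXY R) PXY := by
    have := hc.2.mul_const (log 2)
    exact this.congr (Filter.Eventually.of_forall fun p => (hllr p).symm)
  have hkli := (integrable_klFun_rnDeriv_iff hc.1).2 hllri
  have hklint := integral_klFun_rnDeriv hc.1 hllri
  have hw : PXY = R.withDensity (fun p => ENNReal.ofReal (PXY.rnDeriv R p).toReal) := by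
    conv_lhs => rw [← Measure.withDensity_rnDeriv_eq PXY R hc.1]
    refine withDensity_congr_ae ?_
    filter_upwards [Measure.rnDeriv_lt_top PXY R] with p hp
    rw [ENNReal.ofReal_toReal hp.ne]
  have hmeas : Measurable fun p => (PXY.rnDeriv R p).toReal :=
    (Measure.measurable_rnDeriv _ _).ennreal_toReal
  have hfi : Integrable (fun p => (PXY.rnDeriv R p).toReal) R := Measure.integrable_toReal_rnDeriv
  refine ⟨fun x y => (PXY.rnDeriv R (x, y)).toReal, hmeas, fun _ _ => ENNReal.toReal_nonneg, hw,
    ?_, hkli.integral_prod_left, ?_⟩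
  · have hone : (fun x => ∫⁻ y, ENNReal.ofReal (PXY.rnDeriv R (x, y)).toReal ∂PXY.snd)
        =ᵐ[PXY.fst] fun _ => 1 := by
      refine ae_eq_of_forall_setLIntegral_eq_of_sigmaFinite ?_ measurable_const fun s hs _ => ?_
      · exact hmeas.ennreal_ofReal.lintegral_prod_right'
      · rw [setLIntegral_one, Measure.fst_apply hs, ← Set.prod_univ]
        conv_rhs => rw [hw]
        rw [withDensity_apply _ (hs.prod MeasurableSet.univ), hR, ← Measure.prod_restrict,
          lintegral_prod _ hmeas.ennreal_ofReal.aemeasurable, Measure.restrict_univ]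
    filter_upwards [hfi.prod_right_ae, hkli.prod_right_ae, hone] with x h1 h2 h3
    refine ⟨h1, ?_, h2⟩
    rw [integral_eq_lintegral_of_nonneg_ae (Filter.Eventually.of_forall fun _ =>
      ENNReal.toReal_nonneg) h1.1, h3]
    rfl
  · rw [← integral_prod (fun p : 𝒳 × 𝒴 => klFun (PXY.rnDeriv R (p.1, p.2)).toReal) hkli]
    refine (le_of_eq hklint).trans ?_
    simp only [probReal_univ, add_sub_cancel_right]
    simp_rw [hllr]
    rw [integral_mul_const, klBits, if_pos hc]
    gcongr
    rw [ENNReal.toReal_ofReal']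
    exact le_max_left _ _

lemma exists_emb (α : Type*) [MeasurableSpace α] [StandardBorelSpace α] [Nonempty α] :
    ∃ (i : α → ℝ) (r : ℝ → α), Measurable i ∧ Measurable r ∧ ∀ a, r (i a) = a := by
  have h := measurableEmbedding_embeddingReal α
  obtain ⟨r, hr, hri⟩ := h.exists_measurable_extend measurable_id (fun _ => ‹Nonempty α›)
  exact ⟨_, r, h.measurable, hr, fun a => congrFun hri a⟩

variable {f : 𝒳 → 𝒴 → ℝ} {PX : Measure 𝒳} [IsProbabilityMeasure PX] {Q : Measure 𝒴}
  [IsProbabilityMeasure Q]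

lemma joint_law (hf : Measurable (Function.uncurry f)) (hf0 : ∀ x y, 0 ≤ f x y)
    (hg : ∀ᵐ x ∂PX, Integrable (f x) Q ∧ ∫ y, f x y ∂Q = 1 ∧ Integrable (fun y => klFun (f x y)) Q) :
    (PX.prod (PW Q)).map (fun p => (p.1, (p.2 (Kx Q (f p.1) p.2)).1)) =
      (PX.prod Q).withDensity (fun p => ENNReal.ofReal (f p.1 p.2)) := by
  have hK := measurable_Kx (Q := Q) hf
  have hY : Measurable fun p : 𝒳 × (ℕ → 𝒴 × ℝ) => (p.2 (Kx Q (f p.1) p.2)).1 := by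
    have h1 : Measurable fun q : ℕ × (ℕ → 𝒴 × ℝ) => (q.2 q.1).1 :=
      measurable_from_prod_countable_right fun k => by fun_prop
    exact h1.comp (hK.prodMk measurable_snd)
  have hm : Measurable fun p : 𝒳 × 𝒴 => ENNReal.ofReal (f p.1 p.2) := hf.ennreal_ofReal
  ext S hS
  rw [Measure.map_apply (measurable_fst.prodMk hY) hS,
    Measure.prod_apply ((measurable_fst.prodMk hY) hS), withDensity_apply _ hS,
    ← lintegral_indicator hS, lintegral_prod _ (hm.indicator hS).aemeasurable]
  refine lintegral_congr_ae ?_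
  filter_upwards [hg] with x hx
  have hfx : Measurable (f x) := hf.comp measurable_prodMk_left
  have hSx : MeasurableSet (Prod.mk x ⁻¹' S) := measurable_prodMk_left hS
  have := law (Q := Q) hfx (hf0 x) hx.1 hx.2.1 hSx
  refine Eq.trans this ?_
  rw [← lintegral_indicator hSx]
  rfl

lemma joint_log (hf : Measurable (Function.uncurry f)) (hf0 : ∀ x y, 0 ≤ f x y)
    (hg : ∀ᵐ x ∂PX, Integrable (f x) Q ∧ ∫ y, f x y ∂Q = 1 ∧ Integrable (fun y => klFun (f x y)) Q)
    (hi : Integrable (fun x => ∫ y, klFun (f x y) ∂Q) PX) :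
    Integrable (fun p : 𝒳 × (ℕ → 𝒴 × ℝ) => log ((Kx Q (f p.1) p.2 : ℝ) + 1)) (PX.prod (PW Q)) ∧
    ∫ p, log ((Kx Q (f p.1) p.2 : ℝ) + 1) ∂(PX.prod (PW Q)) ≤
      ∫ x, ∫ y, klFun (f x y) ∂Q ∂PX + log 3 := by
  have hK := measurable_Kx (Q := Q) hf
  have hm : Measurable fun p : 𝒳 × (ℕ → 𝒴 × ℝ) => log ((Kx Q (f p.1) p.2 : ℝ) + 1) := by
    have : Measurable fun n : ℕ => log ((n : ℝ) + 1) := measurable_from_nat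
    exact this.comp hK
  have h0 : ∀ p : 𝒳 × (ℕ → 𝒴 × ℝ), 0 ≤ log ((Kx Q (f p.1) p.2 : ℝ) + 1) := fun p =>
    Real.log_nonneg (by linarith [(Kx Q (f p.1) p.2).cast_nonneg (α := ℝ)])
  have hl3 : 0 ≤ log 3 := Real.log_nonneg (by norm_num)
  have hD0 : ∀ x, 0 ≤ ∫ y, klFun (f x y) ∂Q := fun x =>
    integral_nonneg fun y => klFun_nonneg (hf0 x y)
  have hb : ∫⁻ p, ENNReal.ofReal (log ((Kx Q (f p.1) p.2 : ℝ) + 1)) ∂(PX.prod (PW Q)) ≤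
      ENNReal.ofReal (∫ x, ∫ y, klFun (f x y) ∂Q ∂PX + log 3) := by
    rw [lintegral_prod _ hm.ennreal_ofReal.aemeasurable]
    calc _ ≤ ∫⁻ x, ENNReal.ofReal (∫ y, klFun (f x y) ∂Q + log 3) ∂PX := by
          refine lintegral_mono_ae ?_
          filter_upwards [hg] with x hx
          exact exp_log (hf.comp measurable_prodMk_left) (hf0 x) hx.1 hx.2.1 hx.2.2
      _ = ENNReal.ofReal (∫ x, (∫ y, klFun (f x y) ∂Q + log 3) ∂PX) :=
          (ofReal_integral_eq_lintegral_ofReal (hi.add (integrable_const _))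
            (Filter.Eventually.of_forall fun x => add_nonneg (hD0 x) hl3)).symm
      _ = _ := by rw [integral_add hi (integrable_const _)]; simp
  constructor
  · exact (lintegral_ofReal_ne_top_iff_integrable hm.aestronglyMeasurable
      (Filter.Eventually.of_forall h0)).1 (ne_top_of_le_ne_top ENNReal.ofReal_ne_top hb)
  · rw [integral_eq_lintegral_of_nonneg_ae (Filter.Eventually.of_forall h0)
      hm.aestronglyMeasurable]
    refine ENNReal.toReal_le_of_le_ofReal ?_ hb
    exact add_nonneg (integral_nonneg hD0) hl3

/-- The expected codeword length is finite and bounded as claimed. -/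
lemma joint_len (hf : Measurable (Function.uncurry f)) (hf0 : ∀ x y, 0 ≤ f x y)
    (hg : ∀ᵐ x ∂PX, Integrable (f x) Q ∧ ∫ y, f x y ∂Q = 1 ∧ Integrable (fun y => klFun (f x y)) Q)
    (hi : Integrable (fun x => ∫ y, klFun (f x y) ∂Q) PX) {I : ℝ} (hI : 0 ≤ I)
    (hle : ∫ x, ∫ y, klFun (f x y) ∂Q ∂PX ≤ I * log 2) :
    Integrable (fun p : 𝒳 × (ℕ → 𝒴 × ℝ) =>
      ((code (len (I + logb 2 3)) (Kx Q (f p.1) p.2)).length : ℝ)) (PX.prod (PW Q)) ∧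
    ∫ p, ((code (len (I + logb 2 3)) (Kx Q (f p.1) p.2)).length : ℝ) ∂(PX.prod (PW Q)) ≤
      I + logb 2 (I + 1) + 5 := by
  obtain ⟨hint, hbd⟩ := joint_log (PX := PX) (Q := Q) hf hf0 hg hi
  have hc0 : 0 < logb 2 3 := logb_pos (by norm_num) (by norm_num)
  have hlog2 : 0 < log 2 := Real.log_pos (by norm_num)
  set m := I + logb 2 3 with hm
  have hm0 : 0 < m := by positivity
  have hbint : Integrable (fun p : 𝒳 × (ℕ → 𝒴 × ℝ) => logb 2 ((Kx Q (f p.1) p.2 : ℝ) + 1))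
      (PX.prod (PW Q)) := hint.div_const (log 2)
  have hb : ∫ p, logb 2 ((Kx Q (f p.1) p.2 : ℝ) + 1) ∂(PX.prod (PW Q)) ≤ m := by
    simp only [logb]
    rw [integral_div, div_le_iff₀ hlog2, hm, logb, add_mul, div_mul_cancel₀ _ hlog2.ne']
    linarith
  have hi1 : Integrable (fun p : 𝒳 × (ℕ → 𝒴 × ℝ) =>
      (1 + 1 / m) * logb 2 ((Kx Q (f p.1) p.2 : ℝ) + 1)) (PX.prod (PW Q)) := hbint.const_mul _
  have hi2 : Integrable (fun p : 𝒳 × (ℕ → 𝒴 × ℝ) =>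
      (1 + 1 / m) * logb 2 ((Kx Q (f p.1) p.2 : ℝ) + 1) + logb 2 (1 + m)) (PX.prod (PW Q)) :=
    hi1.add (integrable_const _)
  have hi3 : Integrable (fun p : 𝒳 × (ℕ → 𝒴 × ℝ) =>
      (1 + 1 / m) * logb 2 ((Kx Q (f p.1) p.2 : ℝ) + 1) + logb 2 (1 + m) + 1) (PX.prod (PW Q)) :=
    hi2.add (integrable_const _)
  simp only [code_length]
  have hmeas : Measurable fun p : 𝒳 × (ℕ → 𝒴 × ℝ) => (len m (Kx Q (f p.1) p.2) : ℝ) := by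
    have : Measurable fun n : ℕ => (len m n : ℝ) := measurable_from_nat
    exact this.comp (measurable_Kx hf)
  have hlen : Integrable (fun p : 𝒳 × (ℕ → 𝒴 × ℝ) => (len m (Kx Q (f p.1) p.2) : ℝ))
      (PX.prod (PW Q)) := by
    refine hi3.mono' hmeas.aestronglyMeasurable (Filter.Eventually.of_forall fun p => ?_)
    rw [Real.norm_of_nonneg (Nat.cast_nonneg _)]
    exact len_le hm0 _
  refine ⟨hlen, ?_⟩
  calc _ ≤ ∫ p, ((1 + 1 / m) * logb 2 ((Kx Q (f p.1) p.2 : ℝ) + 1) + logb 2 (1 + m) + 1)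
          ∂(PX.prod (PW Q)) := integral_mono hlen hi3 fun p => len_le hm0 _
    _ = (1 + 1 / m) * ∫ p, logb 2 ((Kx Q (f p.1) p.2 : ℝ) + 1) ∂(PX.prod (PW Q)) +
          logb 2 (1 + m) + 1 := by
        rw [integral_add hi2 (integrable_const _), integral_add hi1 (integrable_const _),
          integral_const_mul]
        simp
    _ ≤ (1 + 1 / m) * m + logb 2 (1 + m) + 1 := by gcongr
    _ ≤ _ := final_arith hI

end Assembly

end ChanSim

/-- **One-shot exact channel simulation with unlimited common randomness** (Section III).
For any joint distribution `P_{XY}` over Polish spaces with `I(X;Y) < ∞`, there are a common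
randomness `W` independent of `X`, a prefix-free encoder `enc` and a decoder `dec` such that
the decoder's output `Ŷ = dec(M, W)` with `M = enc(X, W)` satisfies `(X, Ŷ) ∼ P_{XY}` exactly,
and `E[L(M)] ≤ I(X;Y) + log₂(I(X;Y)+1) + 5` bits. -/
theorem one_shot_exact_channel_simulation
    {𝒳 𝒴 : Type*}
    [TopologicalSpace 𝒳] [PolishSpace 𝒳] [MeasurableSpace 𝒳] [BorelSpace 𝒳]
    [TopologicalSpace 𝒴] [PolishSpace 𝒴] [MeasurableSpace 𝒴] [BorelSpace 𝒴]
    (PXY : Measure (𝒳 × 𝒴)) [IsProbabilityMeasure PXY]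
    (hfin : miOfJoint PXY ≠ ⊤) :
    ∃ (Ω : Type) (_ : MeasurableSpace Ω) (μ : Measure Ω) (_ : IsProbabilityMeasure μ)
      (𝒲 : Type) (_ : MeasurableSpace 𝒲)
      (X : Ω → 𝒳) (W : Ω → 𝒲)
      (enc : 𝒳 × 𝒲 → List Bool) (dec : List Bool × 𝒲 → 𝒴),
      Measurable X ∧ Measurable W ∧ Measurable enc ∧ Measurable dec ∧
      -- the encoder observes X ∼ P_X
      μ.map X = PXY.fst ∧
      -- the common randomness W is independent of X
      IndepFun X W μ ∧
      -- for each value of the common randomness, the codewords form a prefix-free subset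
      -- of {0,1}* (no codeword is a prefix of another)
      (∀ w x₁ x₂, enc (x₁, w) <+: enc (x₂, w) → enc (x₁, w) = enc (x₂, w)) ∧
      -- exact simulation: (X, Ŷ) ∼ P_{XY} where Ŷ = dec(enc(X,W), W)
      μ.map (fun ω => (X ω, dec (enc (X ω, W ω), W ω))) = PXY ∧
      -- expected description length E[L(M)] ≤ I(X;Y) + log₂(I(X;Y)+1) + 5
      ∫ ω, ((enc (X ω, W ω)).length : ℝ) ∂μ ≤
        (miOfJoint PXY).toReal +
          Real.logb 2 ((miOfJoint PXY).toReal + 1) + 5 := by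
  classical
  obtain ⟨f, hf, hf0, hw, hg, hi, hle⟩ := ChanSim.density PXY hfin
  set I := (miOfJoint PXY).toReal with hIdef
  have hI : 0 ≤ I := ENNReal.toReal_nonneg
  have hc0 : 0 < logb 2 3 := logb_pos (by norm_num) (by norm_num)
  have hm0 : 0 < I + logb 2 3 := by positivity
  set ℓ := ChanSim.len (I + logb 2 3) with hℓ
  have hpre : ∀ {i j : ℕ}, ChanSim.code ℓ i <+: ChanSim.code ℓ j → i = j := fun h =>
    ChanSim.code_prefix (ChanSim.len_mono hm0) (ChanSim.len_kraft hm0) h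
  have hinj : Function.Injective (ChanSim.code ℓ) := fun i j h =>
    hpre (h ▸ List.prefix_rfl)
  set Q := PXY.snd with hQ
  set PX := PXY.fst with hPX
  obtain ⟨p0⟩ : Nonempty (𝒳 × 𝒴) := PXY.nonempty_of_neZero
  haveI : Nonempty 𝒴 := ⟨p0.2⟩
  haveI : Nonempty 𝒳 := ⟨p0.1⟩
  obtain ⟨i1, r1, hi1, hr1, h1⟩ := ChanSim.exists_emb (𝒳 × (ℕ → 𝒴 × ℝ))
  obtain ⟨i2, r2, hi2, hr2, h2⟩ := ChanSim.exists_emb (ℕ → 𝒴 × ℝ)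
  have hK := ChanSim.measurable_Kx (Q := Q) hf
  have hcode : Measurable (ChanSim.code ℓ) := measurable_from_nat
  haveI : MeasurableSingletonClass (List Bool) := ⟨fun _ => trivial⟩
  set ν := PX.prod (ChanSim.PW Q) with hν
  set X : ℝ → 𝒳 := fun ω => (r1 ω).1 with hX
  set W : ℝ → ℝ := fun ω => i2 (r1 ω).2 with hW
  set enc : 𝒳 × ℝ → List Bool := fun q => ChanSim.code ℓ (ChanSim.Kx Q (f q.1) (r2 q.2)) with henc
  set dec : List Bool × ℝ → 𝒴 :=
    fun q => (r2 q.2 (Function.invFun (ChanSim.code ℓ) q.1)).1 with hdec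
  have hXm : Measurable X := hr1.fst
  have hWm : Measurable W := hi2.comp hr1.snd
  have hencm : Measurable enc :=
    hcode.comp (hK.comp (measurable_fst.prodMk (hr2.comp measurable_snd)))
  have hdecm : Measurable dec := by
    refine measurable_from_prod_countable_right fun m => ?_
    have h : Measurable fun w : ℕ → 𝒴 × ℝ => (w (Function.invFun (ChanSim.code ℓ) m)).1 := by
      fun_prop
    exact h.comp hr2
  haveI hprob : IsProbabilityMeasure (ν.map i1) := Measure.isProbabilityMeasure_map hi1.aemeasurable
  have hXmap : (ν.map i1).map X = PX := by
    rw [Measure.map_map hXm hi1]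
    have : X ∘ i1 = Prod.fst := by ext p; simp [hX, h1]
    rw [this]
    exact Measure.fst_prod
  have hWmap : (ν.map i1).map W = (ChanSim.PW Q).map i2 := by
    rw [Measure.map_map hWm hi1]
    have : W ∘ i1 = i2 ∘ Prod.snd := by ext p; simp [hW, h1]
    rw [this, ← Measure.map_map hi2 measurable_snd]
    congr 1
    exact Measure.snd_prod
  have hY : ∀ p, dec (enc (X (i1 p), W (i1 p)), W (i1 p)) =
      (p.2 (ChanSim.Kx Q (f p.1) p.2)).1 := by
    intro p
    simp only [hX, hW, henc, hdec, h1, h2, Function.leftInverse_invFun hinj _]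
  refine ⟨ℝ, inferInstance, ν.map i1, hprob, ℝ, inferInstance, X, W, enc, dec, hXm, hWm, hencm,
    hdecm, hXmap, ?_, ?_, ?_, ?_⟩
  · rw [indepFun_iff_map_prod_eq_prod_map_map hXm.aemeasurable hWm.aemeasurable, hXmap, hWmap,
      Measure.map_map (hXm.prodMk hWm) hi1]
    have : (fun ω => (X ω, W ω)) ∘ i1 = Prod.map id i2 := by
      ext p <;> simp [hX, hW, h1]
    rw [this, hν, ← Measure.map_prod_map _ _ measurable_id hi2, Measure.map_id]
  · intro w x₁ x₂ h
    simp only [henc] at h ⊢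
    rw [hpre h]
  · have hm : Measurable fun ω => (X ω, dec (enc (X ω, W ω), W ω)) :=
      hXm.prodMk (hdecm.comp ((hencm.comp (hXm.prodMk hWm)).prodMk hWm))
    rw [Measure.map_map hm hi1]
    have : (fun ω => (X ω, dec (enc (X ω, W ω), W ω))) ∘ i1 =
        fun p => (p.1, (p.2 (ChanSim.Kx Q (f p.1) p.2)).1) := by
      funext p
      simp only [Function.comp, hY]
      simp only [hX, h1]
    rw [this, hν, ChanSim.joint_law hf hf0 hg]
    exact hw.symm
  · have hL : Measurable fun ω => ((enc (X ω, W ω)).length : ℝ) := by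
      have : Measurable fun m : List Bool => (m.length : ℝ) := measurable_from_top
      exact this.comp (hencm.comp (hXm.prodMk hWm))
    rw [integral_map hi1.aemeasurable hL.aestronglyMeasurable]
    have := (ChanSim.joint_len (PX := PX) (Q := Q) hf hf0 hg hi hI hle).2
    simpa only [henc, hX, hW, h1, h2] using this
end
end
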